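/- arXiv:2309.06821 — 14 statements merged into one kernel-verified Lean document; each statement's English description precedes it below -/
import Mathlib

section
/- Let F be a finite field with q elements, q ≡ 1 (mod 3), and let θ ∈ F be a nonzero element that is not a cube. Then the only solution in F of the equation x³ + θ·y³ + θ²·z³ − 3θ·x·y·z = 0 is x = y = z = 0. -/
/-- If `θ` is not a cube, the equations `a² = θbc`, `b² = ac`, `θc² = ab` have only the trivial
solution. -/
theorem eq_zero_of_minors_eq_zero {F : Type*} [Field F] {θ a b c : F}
    (hncube : ¬ ∃ u : F, u ^ 3 = θ) (ha : a ^ 2 = θ * b * c) (hb : b ^ 2 = a * c)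
    (hc : θ * c ^ 2 = a * b) : a = 0 ∧ b = 0 ∧ c = 0 := by
  have hc0 : c = 0 := by
    by_contra h
    refine hncube ⟨b / c, ?_⟩
    rw [div_pow, div_eq_iff (pow_ne_zero 3 h)]
    linear_combination b * hb - c * hc
  subst hc0
  exact ⟨by simpa using ha, by simpa using hb, rfl⟩

theorem cubic_form_only_trivial_zero
    (F : Type*) [Field F] [Fintype F] (q : ℕ)
    (hcard : Fintype.card F = q) (hq : q % 3 = 1)
    (θ : F) (hθ : θ ≠ 0) (hncube : ¬ ∃ u : F, u ^ 3 = θ) :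
    ∀ x y z : F, x ^ 3 + θ * y ^ 3 + θ ^ 2 * z ^ 3 - 3 * θ * x * y * z = 0 →
      x = 0 ∧ y = 0 ∧ z = 0 := by
  intro x y z h
  obtain ⟨hA, hB, hC⟩ := eq_zero_of_minors_eq_zero (a := x ^ 2 - θ * y * z)
    (b := θ * z ^ 2 - x * y) (c := y ^ 2 - x * z) hncube
    (by linear_combination x * h) (by linear_combination z * h) (by linear_combination y * h)
  exact eq_zero_of_minors_eq_zero hncube (sub_eq_zero.mp hA) (sub_eq_zero.mp hC)
    (sub_eq_zero.mp hB)
end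

section
/- Let F be a finite field with q elements, q ≡ 1 (mod 3), and let ω ∈ F be a nonzero element that is not a cube. For every triple (b₁,b₂,b₃) ∈ F³ with (b₁,b₂,b₃) ≠ (0,0,0), the 3×3 matrix with rows (b₁, b₂, b₃), (ω·b₂, ω·b₃, b₁), (ω·b₃, b₁, b₂) is invertible; equivalently, its determinant 3ω·b₁b₂b₃ − b₁³ − ω·b₂³ − ω²·b₃³ is nonzero. -/
/-- Over any field, the norm form of `X ^ 3 - ω` is anisotropic when `ω` is not a cube. -/
theorem eq_zero_of_cubic_norm_eq_zero {K : Type*} [Field K] {ω : K}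
    (hω : ¬ ∃ u : K, u ^ 3 = ω) {a b c : K}
    (h : a ^ 3 + ω * b ^ 3 + ω ^ 2 * c ^ 3 - 3 * ω * (a * b * c) = 0) :
    a = 0 ∧ b = 0 ∧ c = 0 := by
  have eq_zero_of_cube {r p : K} (hrp : r ^ 3 + ω * p ^ 3 = 0) : p = 0 := by
    by_contra hp
    refine hω ⟨-r / p, ?_⟩
    rw [div_pow, div_eq_iff (pow_ne_zero 3 hp)]
    linear_combination -hrp
  -- `r + p X` is the product of `a + b X + c X ^ 2` and `b - c X` modulo `X ^ 3 - ω`.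
  have hp : b ^ 2 - a * c = 0 := eq_zero_of_cube (r := a * b - c ^ 2 * ω) <| by
    linear_combination (b ^ 3 - ω * c ^ 3) * h
  have hr : a * b - c ^ 2 * ω = 0 := by
    refine pow_eq_zero_iff (n := 3) (by norm_num) |>.mp ?_
    linear_combination (b ^ 3 - ω * c ^ 3) * h - ω * (b ^ 2 - a * c) ^ 2 * hp
  have hc : c = 0 := neg_eq_zero.mp <| eq_zero_of_cube (r := b) <| by
    linear_combination b * hp + c * hr
  subst hc
  have hb : b = 0 := eq_zero_of_cube (r := a) <| by linear_combination h
  subst hb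
  refine ⟨pow_eq_zero_iff (n := 3) (by norm_num) |>.mp ?_, rfl, rfl⟩
  linear_combination h

theorem circulant_like_matrix_invertible
    (F : Type*) [Field F] [Fintype F] (q : ℕ)
    (hcard : Fintype.card F = q) (hq : q % 3 = 1)
    (ω : F) (hω : ω ≠ 0) (hncube : ¬ ∃ u : F, u ^ 3 = ω)
    (b₁ b₂ b₃ : F) (hb : ¬ (b₁ = 0 ∧ b₂ = 0 ∧ b₃ = 0)) :
    IsUnit (!![b₁, b₂, b₃; ω * b₂, ω * b₃, b₁; ω * b₃, b₁, b₂]) ∧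
      3 * ω * (b₁ * b₂ * b₃) - b₁ ^ 3 - ω * b₂ ^ 3 - ω ^ 2 * b₃ ^ 3 ≠ 0 := by
  have hdet : 3 * ω * (b₁ * b₂ * b₃) - b₁ ^ 3 - ω * b₂ ^ 3 - ω ^ 2 * b₃ ^ 3 ≠ 0 :=
    fun h => hb <| eq_zero_of_cubic_norm_eq_zero hncube <| by linear_combination -h
  refine ⟨?_, hdet⟩
  rw [Matrix.isUnit_iff_isUnit_det, isUnit_iff_ne_zero, Matrix.det_fin_three]
  convert hdet using 1
  simp
  ring
end

section
/- Let F be a finite field with q elements, q ≡ 1 (mod 3), and let ω ∈ F be a nonzero element that is not a cube. If a₁,a₂,a₃,b₁,b₂,b₃ ∈ F satisfy the three equations a₁b₁ + a₂b₂ + a₃b₃ = 0, ω·a₁b₂ + ω·a₂b₃ + a₃b₁ = 0, and ω·a₁b₃ + a₂b₁ + a₃b₂ = 0, then (a₁,a₂,a₃) = (0,0,0) or (b₁,b₂,b₃) = (0,0,0). -/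
/-- If `ω` is not a cube, then `(x : y : z)` cannot be proportional to `(t² : t : 1)` with
`t ^ 3 = ω`, here expressed without division. -/
theorem eq_zero_of_proportional_of_not_cube {K : Type*} [Field K] {ω x y z : K}
    (hω : ¬ ∃ u : K, u ^ 3 = ω) (hy : y ^ 2 = x * z) (hxy : x * y = ω * z ^ 2)
    (hx : x ^ 2 = ω * (y * z)) : x = 0 ∧ y = 0 ∧ z = 0 := by
  have hz : z = 0 := by
    by_contra hz
    refine hω ⟨y / z, ?_⟩
    rw [div_pow, div_eq_iff (pow_ne_zero 3 hz)]
    linear_combination y * hy + z * hxy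
  subst hz
  simp_all

/-- The norm form of `X ^ 3 - ω` is anisotropic when `ω` is not a cube. -/
theorem eq_zero_of_cubic_norm_form_eq_zero {K : Type*} [Field K] {ω x y z : K}
    (hω : ¬ ∃ u : K, u ^ 3 = ω)
    (h : x ^ 3 + ω * y ^ 3 + ω ^ 2 * z ^ 3 - 3 * ω * x * y * z = 0) :
    x = 0 ∧ y = 0 ∧ z = 0 := by
  obtain ⟨hu, hv, hw⟩ := eq_zero_of_proportional_of_not_cube
    (x := x ^ 2 - ω * (y * z)) (y := ω * z ^ 2 - x * y) (z := y ^ 2 - x * z) hω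
    (by linear_combination z * h) (by linear_combination -y * h) (by linear_combination x * h)
  exact eq_zero_of_proportional_of_not_cube hω (sub_eq_zero.mp hw) (sub_eq_zero.mp hv).symm
    (sub_eq_zero.mp hu)

theorem system_only_trivial_solutions
    (F : Type*) [Field F] [Fintype F] (q : ℕ)
    (hcard : Fintype.card F = q) (hq : q % 3 = 1)
    (ω : F) (hω : ω ≠ 0) (hncube : ¬ ∃ u : F, u ^ 3 = ω)
    (a₁ a₂ a₃ b₁ b₂ b₃ : F)
    (h1 : a₁ * b₁ + a₂ * b₂ + a₃ * b₃ = 0)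
    (h2 : ω * (a₁ * b₂) + ω * (a₂ * b₃) + a₃ * b₁ = 0)
    (h3 : ω * (a₁ * b₃) + a₂ * b₁ + a₃ * b₂ = 0) :
    (a₁ = 0 ∧ a₂ = 0 ∧ a₃ = 0) ∨ (b₁ = 0 ∧ b₂ = 0 ∧ b₃ = 0) := by
  by_cases hN : a₃ ^ 3 + ω * a₂ ^ 3 + ω ^ 2 * a₁ ^ 3 - 3 * ω * a₃ * a₂ * a₁ = 0
  · obtain ⟨h₃, h₂, h₁⟩ := eq_zero_of_cubic_norm_form_eq_zero hncube hN
    exact Or.inl ⟨h₁, h₂, h₃⟩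
  · refine Or.inr ⟨?_, ?_, ?_⟩ <;> refine (mul_eq_zero.mp ?_).resolve_left hN
    · linear_combination (ω ^ 2 * a₁ ^ 2 - ω * a₂ * a₃) * h1 + (a₃ ^ 2 - ω * a₁ * a₂) * h2
        + (ω * a₂ ^ 2 - ω * a₁ * a₃) * h3
    · linear_combination (ω * a₂ ^ 2 - ω * a₁ * a₃) * h1 + (ω * a₁ ^ 2 - a₂ * a₃) * h2
        + (a₃ ^ 2 - ω * a₁ * a₂) * h3
    · linear_combination (a₃ ^ 2 - ω * a₁ * a₂) * h1 + (a₂ ^ 2 - a₁ * a₃) * h2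
        + (ω * a₁ ^ 2 - a₂ * a₃) * h3
end

section
/- Let F be a finite field with q elements, q ≡ 1 (mod 3), and let ζ ∈ F be a primitive cube root of unity (ζ³ = 1 and ζ ≠ 1). The number of invertible 3×3 matrices A over F for which there exists a nonzero λ ∈ F with A·D = λ·D·A, where D = diag(1, ζ, ζ²), equals 3(q−1)³. (Consequently, the orbit of the projective point D under conjugation by PGL(3,q) has size q³(q+1)(q²+q+1)/3.) -/
/-- The monomial matrix with entry `u i` at position `(i, i + s)` and zeros elsewhere. -/
def cyclicMonomial {F : Type*} [Field F] (p : Fin 3 × (Fin 3 → Fˣ)) :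
    Matrix (Fin 3) (Fin 3) F :=
  Matrix.of fun i j => if j = i + p.1 then (p.2 i : F) else 0

theorem cyclicMonomial_injective {F : Type*} [Field F] :
    Function.Injective (cyclicMonomial (F := F)) := by
  rintro ⟨s, u⟩ ⟨t, v⟩ h
  have hst : s = t := by
    have h0 := congrFun (congrFun h 0) s
    by_contra hne
    simp [cyclicMonomial, hne] at h0
  subst hst
  refine Prod.ext rfl (funext fun i => Units.ext ?_)
  simpa [cyclicMonomial] using congrFun (congrFun h i) (i + s)

theorem isUnit_cyclicMonomial {F : Type*} [Field F] (p : Fin 3 × (Fin 3 → Fˣ)) :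
    IsUnit (cyclicMonomial p) := by
  obtain ⟨s, u⟩ := p
  rw [Matrix.isUnit_iff_isUnit_det, isUnit_iff_ne_zero, Matrix.det_fin_three]
  fin_cases s <;> simp [cyclicMonomial, Fin.ext_iff, Fin.val_add]

theorem pow_val_add {F : Type*} [Field F] {ζ : F} (hζ3 : ζ ^ 3 = 1) (i s : Fin 3) :
    ζ ^ ((i + s : Fin 3) : ℕ) = ζ ^ (s : ℕ) * ζ ^ (i : ℕ) := by
  rw [Fin.val_add, ← pow_eq_pow_mod _ hζ3, pow_add, mul_comm]

theorem mul_diagonal_eq_smul_iff {F : Type*} [Field F] (ζ l : F)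
    (A : Matrix (Fin 3) (Fin 3) F) :
    A * Matrix.diagonal ![1, ζ, ζ ^ 2] = l • (Matrix.diagonal ![1, ζ, ζ ^ 2] * A) ↔
      ∀ i j, A i j ≠ 0 → ζ ^ (j : ℕ) = l * ζ ^ (i : ℕ) := by
  have hd : ![1, ζ, ζ ^ 2] = fun i : Fin 3 => ζ ^ (i : ℕ) := by
    funext i
    fin_cases i <;> simp
  rw [hd, ← Matrix.ext_iff]
  refine forall₂_congr fun i j => ?_
  rw [Matrix.mul_diagonal, Matrix.smul_apply, Matrix.diagonal_mul, smul_eq_mul, ← mul_assoc,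
    mul_comm (A i j), mul_eq_mul_right_iff, or_iff_not_imp_right]

theorem range_cyclicMonomial {F : Type*} [Field F] {ζ : F} (hζ3 : ζ ^ 3 = 1) (hζ1 : ζ ≠ 1) :
    {A : Matrix (Fin 3) (Fin 3) F | IsUnit A ∧
        ∃ l : F, l ≠ 0 ∧
          A * Matrix.diagonal ![1, ζ, ζ ^ 2] =
            l • (Matrix.diagonal ![1, ζ, ζ ^ 2] * A)} = Set.range cyclicMonomial := by
  have hζ : IsPrimitiveRoot ζ 3 := by
    have : Fact (Nat.Prime 3) := ⟨Nat.prime_three⟩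
    exact IsPrimitiveRoot.iff_orderOf.mpr (orderOf_eq_prime hζ3 hζ1)
  have hζ0 : ζ ≠ 0 := hζ.ne_zero (by norm_num)
  simp only [mul_diagonal_eq_smul_iff]
  ext A
  constructor
  · rintro ⟨hA, l, -, h⟩
    have hdet : A.det ≠ 0 := isUnit_iff_ne_zero.mp ((Matrix.isUnit_iff_isUnit_det A).mp hA)
    have hrow : ∀ i, ∃ j, A i j ≠ 0 := fun i => by
      by_contra! hi
      exact hdet (Matrix.det_eq_zero_of_row_eq_zero i hi)
    obtain ⟨s, hs⟩ := hrow 0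
    have hl : l = ζ ^ (s : ℕ) := by simpa using (h 0 s hs).symm
    have hsupp : ∀ i j, A i j ≠ 0 → j = i + s := fun i j hij => by
      refine Fin.ext (hζ.pow_inj j.isLt (i + s).isLt ?_)
      rw [h i j hij, hl, pow_val_add hζ3]
    have hne : ∀ i, A i (i + s) ≠ 0 := fun i => by
      obtain ⟨j, hj⟩ := hrow i
      exact hsupp i j hj ▸ hj
    refine ⟨(s, fun i => Units.mk0 _ (hne i)), ?_⟩
    ext i j
    by_cases hj : j = i + s
    · simp [cyclicMonomial, hj]
    · simpa [cyclicMonomial, hj] using (not_imp_comm.mp (hsupp i j) hj).symm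
  · rintro ⟨⟨s, u⟩, rfl⟩
    refine ⟨isUnit_cyclicMonomial _, ζ ^ (s : ℕ), pow_ne_zero _ hζ0, fun i j hij => ?_⟩
    have hj : j = i + s := by
      by_contra hj
      simp [cyclicMonomial, hj] at hij
    rw [hj, pow_val_add hζ3]


theorem stabilizer_count_diag
    (F : Type*) [Field F] [Fintype F] (q : ℕ)
    (hcard : Fintype.card F = q) (hq : q % 3 = 1)
    (ζ : F) (hζ3 : ζ ^ 3 = 1) (hζ1 : ζ ≠ 1) :
    {A : Matrix (Fin 3) (Fin 3) F | IsUnit A ∧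
        ∃ l : F, l ≠ 0 ∧
          A * Matrix.diagonal ![1, ζ, ζ ^ 2] =
            l • (Matrix.diagonal ![1, ζ, ζ ^ 2] * A)}.ncard
      = 3 * (q - 1) ^ 3 := by
  classical
  rw [range_cyclicMonomial hζ3 hζ1, ← Set.image_univ,
    Set.ncard_image_of_injective _ cyclicMonomial_injective, Set.ncard_univ,
    Nat.card_eq_fintype_card, Fintype.card_prod, Fintype.card_fun, Fintype.card_fin,
    Fintype.card_units, hcard]
end

section
/- Let F be a finite field with q elements, q ≡ 1 (mod 3). Let (a,b) and (a',b') be flags that are projectively distinct, i.e., it is not the case that a' is a scalar multiple of a and b' is a scalar multiple of b. Then the dimension over F of the intersection π(a,b) ∩ π(a',b') equals: 2, if a' is a scalar multiple of a or b' is a scalar multiple of b; otherwise 1, if b·a' = 0 or b'·a = 0; and 0 otherwise. (This expresses that the planes π_x and π_y of Q⁺(7,q) meet in a line of Γ, a point of Γ, or are disjoint, according to whether the points x, y of the hexagon Γ are at distance 2, 4 or 6.) -/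
open Matrix

/-- A flag: a pair of nonzero vectors `a`, `b` of `F³` with `b ⬝ᵥ a = 0`. -/
def IsFlag {F : Type*} [Field F] (a b : Fin 3 → F) : Prop :=
  a ≠ 0 ∧ b ≠ 0 ∧ b ⬝ᵥ a = 0

/-- The plane `π(a,b)` of `Q⁺(7,q)` associated with a flag `(a,b)`:
all matrices `a·cᵀ + d·bᵀ` with `c ⬝ᵥ a = 0` and `d ⬝ᵥ b = 0`. -/
def flagPlane {F : Type*} [Field F] (a b : Fin 3 → F) : Set (Matrix (Fin 3) (Fin 3) F) :=
  {M | ∃ c d : Fin 3 → F, c ⬝ᵥ a = 0 ∧ d ⬝ᵥ b = 0 ∧ M = vecMulVec a c + vecMulVec d b}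

theorem exists_smul_eq_of_dotProduct_eq_zero {F : Type*} [Field F] {u v x y : Fin 3 → F}
    (hu : u ≠ 0) (hv : ¬ ∃ s : F, v = s • u) (hy : y ≠ 0)
    (hxu : x ⬝ᵥ u = 0) (hxv : x ⬝ᵥ v = 0) (hyu : y ⬝ᵥ u = 0) (hyv : y ⬝ᵥ v = 0) :
    ∃ r : F, x = r • y := by
  have hn : crossProduct u v ≠ 0 := by
    rw [crossProduct_ne_zero_iff_linearIndependent, LinearIndependent.pair_iff' hu]
    exact fun s hs => hv ⟨s, hs.symm⟩
  have key : ∀ w : Fin 3 → F, w ⬝ᵥ u = 0 → w ⬝ᵥ v = 0 →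
      ∃ r : F, w = r • crossProduct u v := by
    intro w hwu hwv
    have h0 : crossProduct (crossProduct u v) w = 0 := by
      rw [cross_cross_eq_smul_sub_smul, dotProduct_comm u, dotProduct_comm v, hwu, hwv]
      simp
    by_contra! hr
    refine crossProduct_ne_zero_iff_linearIndependent.mpr
      ((LinearIndependent.pair_iff' hn).mpr fun r h => hr r h.symm) h0
  obtain ⟨r, rfl⟩ := key x hxu hxv
  obtain ⟨t, rfl⟩ := key y hyu hyv
  have ht : t ≠ 0 := by
    rintro rfl
    simp at hy
  exact ⟨r / t, by rw [smul_smul, div_mul_cancel₀ _ ht]⟩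

theorem mulVec_eq_zero_of_mem_flagPlane {F : Type*} [Field F] {a b : Fin 3 → F}
    (hba : b ⬝ᵥ a = 0) {M : Matrix (Fin 3) (Fin 3) F} (hM : M ∈ flagPlane a b) :
    M *ᵥ a = 0 := by
  obtain ⟨c, d, hc, hd, rfl⟩ := hM
  simp [add_mulVec, vecMulVec_mulVec, hc, hba]

theorem vecMul_eq_zero_of_mem_flagPlane {F : Type*} [Field F] {a b : Fin 3 → F}
    (hba : b ⬝ᵥ a = 0) {M : Matrix (Fin 3) (Fin 3) F} (hM : M ∈ flagPlane a b) :
    b ᵥ* M = 0 := by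
  obtain ⟨c, d, hc, hd, rfl⟩ := hM
  simp [vecMul_add, vecMul_vecMulVec, hba, dotProduct_comm b d, hd]

theorem transpose_mem_flagPlane_iff {F : Type*} [Field F] {a b : Fin 3 → F}
    {M : Matrix (Fin 3) (Fin 3) F} : Mᵀ ∈ flagPlane b a ↔ M ∈ flagPlane a b := by
  constructor
  · rintro ⟨c, d, hc, hd, h⟩
    refine ⟨d, c, hd, hc, ?_⟩
    rw [← transpose_transpose M, h, transpose_add, transpose_vecMulVec, transpose_vecMulVec,
      add_comm]
  · rintro ⟨c, d, hc, hd, rfl⟩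
    exact ⟨d, c, hd, hc, by
      rw [transpose_add, transpose_vecMulVec, transpose_vecMulVec, add_comm]⟩

theorem finrank_span_flagPlane_inter_transpose {F : Type*} [Field F] (a b a' b' : Fin 3 → F) :
    Module.finrank F (Submodule.span F (flagPlane b a ∩ flagPlane b' a')) =
      Module.finrank F (Submodule.span F (flagPlane a b ∩ flagPlane a' b')) := by
  let e := transposeLinearEquiv (Fin 3) (Fin 3) F F
  have himage : flagPlane b a ∩ flagPlane b' a' =
      (e : Matrix (Fin 3) (Fin 3) F →ₗ[F] _) '' (flagPlane a b ∩ flagPlane a' b') := by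
    ext M
    constructor
    · rintro ⟨h, h'⟩
      exact ⟨Mᵀ, ⟨transpose_mem_flagPlane_iff.mpr h, transpose_mem_flagPlane_iff.mpr h'⟩,
        transpose_transpose M⟩
    · rintro ⟨N, ⟨h, h'⟩, rfl⟩
      exact ⟨transpose_mem_flagPlane_iff.mpr h, transpose_mem_flagPlane_iff.mpr h'⟩
  rw [himage, ← Submodule.map_span, LinearEquiv.finrank_map_eq]

theorem finrank_span_flagPlane_inter_of_smul_left {F : Type*} [Field F] {a b a' b' : Fin 3 → F}
    (hf : IsFlag a b) (hf' : IsFlag a' b') (ha : ∃ s : F, a' = s • a)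
    (hb : ¬ ∃ t : F, b' = t • b) :
    Module.finrank F (Submodule.span F (flagPlane a b ∩ flagPlane a' b')) = 2 := by
  obtain ⟨s, rfl⟩ := ha
  obtain ⟨ha0, hb0, hba⟩ := hf
  obtain ⟨ha0', hb0', hba'⟩ := hf'
  have hs : s ≠ 0 := by
    rintro rfl
    simp at ha0'
  have hb'a : b' ⬝ᵥ a = 0 := by simpa [hs] using hba'
  let φ : Module.Dual F (Fin 3 → F) := (dotProductBilin F F).flip a
  have hφ : ∀ c, φ c = c ⬝ᵥ a := fun _ => rfl
  have hφ0 : φ ≠ 0 := by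
    intro h
    refine ha0 (dotProduct_eq_zero_iff.mp fun c => ?_)
    rw [dotProduct_comm, ← hφ, h, LinearMap.zero_apply]
  let ψ : (Fin 3 → F) →ₗ[F] Matrix (Fin 3) (Fin 3) F := vecMulVecBilin F F a
  have hψ : ∀ c, ψ c = vecMulVec a c := fun _ => rfl
  have hψinj : Function.Injective ψ := by
    rw [injective_iff_map_eq_zero]
    intro c hc
    exact (vecMulVec_eq_zero.mp hc).resolve_left ha0
  have hinter : flagPlane a b ∩ flagPlane (s • a) b' = ((LinearMap.ker φ).map ψ : Set _) := by
    ext M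
    constructor
    · rintro ⟨⟨c, d, hc, hd, rfl⟩, hM'⟩
      have h := vecMul_eq_zero_of_mem_flagPlane hba' hM'
      have hdb' : d ⬝ᵥ b' = 0 := by
        simpa [vecMul_add, vecMul_vecMulVec, hb'a, hb0, dotProduct_comm b' d] using h
      obtain ⟨r, rfl⟩ := exists_smul_eq_of_dotProduct_eq_zero hb0 hb ha0 hd hdb'
        (by rw [dotProduct_comm, hba]) (by rw [dotProduct_comm, hb'a])
      refine ⟨c + r • b, ?_, ?_⟩
      · simp [hφ, add_dotProduct, hc, hba]
      · rw [hψ, vecMulVec_add, vecMulVec_smul, smul_vecMulVec]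
    · rintro ⟨c, hc, rfl⟩
      have hc : c ⬝ᵥ a = 0 := hc
      refine ⟨⟨c, 0, hc, by simp, by simp [hψ]⟩, s⁻¹ • c, 0, by simp [hc], by simp, ?_⟩
      rw [hψ, smul_vecMulVec, vecMulVec_smul, smul_smul, mul_inv_cancel₀ hs]
      simp
  rw [hinter, Submodule.span_eq,
    (Submodule.equivMapOfInjective ψ hψinj _).finrank_eq.symm]
  have := Module.Dual.finrank_ker_add_one_of_ne_zero hφ0
  rw [Module.finrank_fin_fun] at this
  omega

theorem finrank_span_flagPlane_inter_of_dotProduct_eq_zero {F : Type*} [Field F]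
    {a b a' b' : Fin 3 → F} (hf : IsFlag a b) (hf' : IsFlag a' b')
    (ha : ¬ ∃ s : F, a' = s • a) (hb : ¬ ∃ t : F, b' = t • b) (hba' : b ⬝ᵥ a' = 0) :
    Module.finrank F (Submodule.span F (flagPlane a b ∩ flagPlane a' b')) = 1 := by
  obtain ⟨ha0, hb0, hba⟩ := hf
  obtain ⟨ha0', hb0', hb'a'⟩ := hf'
  have hspan : Submodule.span F (flagPlane a b ∩ flagPlane a' b') =
      Submodule.span F {vecMulVec a' b} := by
    apply le_antisymm
    · rw [Submodule.span_le]
      rintro M ⟨⟨c, d, hc, hd, rfl⟩, hM'⟩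
      have hca' : c ⬝ᵥ a' = 0 := by
        simpa [add_mulVec, vecMulVec_mulVec, hba', ha0] using
          mulVec_eq_zero_of_mem_flagPlane hb'a' hM'
      obtain ⟨r, rfl⟩ := exists_smul_eq_of_dotProduct_eq_zero ha0 ha hb0 hc hca' hba hba'
      have heq : vecMulVec a (r • b) + vecMulVec d b = vecMulVec (r • a + d) b := by
        rw [add_vecMulVec, vecMulVec_smul, smul_vecMulVec]
      rw [heq] at hM' ⊢
      have hb'd : (r • a + d) ⬝ᵥ b' = 0 := by
        have h := vecMul_eq_zero_of_mem_flagPlane hb'a' hM'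
        rw [vecMul_vecMulVec, smul_eq_zero] at h
        rw [dotProduct_comm]
        exact h.resolve_right hb0
      obtain ⟨t, ht⟩ := exists_smul_eq_of_dotProduct_eq_zero (x := r • a + d) hb0 hb ha0'
        (by simp [add_dotProduct, hd, dotProduct_comm a b, hba]) hb'd
        (by rw [dotProduct_comm, hba']) (by rw [dotProduct_comm, hb'a'])
      rw [ht, smul_vecMulVec]
      exact Submodule.smul_mem _ _ (Submodule.mem_span_singleton_self _)
    · rw [Submodule.span_singleton_le_iff_mem]
      exact Submodule.subset_span
        ⟨⟨0, a', by simp, by rw [dotProduct_comm, hba'], by simp⟩, b, 0, hba', by simp, by simp⟩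
  rw [hspan, finrank_span_singleton]
  exact fun h => (vecMulVec_eq_zero.mp h).elim ha0' hb0

theorem flagPlane_inter_subset_of_dotProduct_ne_zero {F : Type*} [Field F]
    {a b a' b' : Fin 3 → F} (hf : IsFlag a b) (hf' : IsFlag a' b')
    (hba' : b ⬝ᵥ a' ≠ 0) (hb'a : b' ⬝ᵥ a ≠ 0) :
    flagPlane a b ∩ flagPlane a' b' ⊆ {0} := by
  obtain ⟨-, -, hba⟩ := hf
  obtain ⟨-, -, hb'a'⟩ := hf'
  rintro M ⟨⟨c, d, hc, hd, rfl⟩, hM'⟩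
  have h := mulVec_eq_zero_of_mem_flagPlane hb'a' hM'
  obtain ⟨r, rfl⟩ : ∃ r : F, d = r • a := by
    refine ⟨-(b ⬝ᵥ a')⁻¹ * (c ⬝ᵥ a'), ?_⟩
    simp only [add_mulVec, vecMulVec_mulVec, op_smul_eq_smul] at h
    rw [mul_smul, eq_neg_of_add_eq_zero_left h, smul_neg, neg_smul, neg_neg, smul_smul,
      inv_mul_cancel₀ hba', one_smul]
  have heq : vecMulVec a c + vecMulVec (r • a) b = vecMulVec a (c + r • b) := by
    rw [vecMulVec_add, vecMulVec_smul, smul_vecMulVec]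
  rw [heq] at hM' ⊢
  have h' := vecMul_eq_zero_of_mem_flagPlane hb'a' hM'
  rw [vecMul_vecMulVec, smul_eq_zero] at h'
  simp [h'.resolve_left hb'a]

theorem exists_eq_smul_symm {F : Type*} [Field F] {u v : Fin 3 → F} (hv : v ≠ 0)
    (h : ∃ s : F, v = s • u) : ∃ s : F, u = s • v := by
  obtain ⟨s, rfl⟩ := h
  have hs : s ≠ 0 := fun hs => hv (by simp [hs])
  exact ⟨s⁻¹, (inv_smul_smul₀ hs u).symm⟩

theorem flagPlanes_intersection_dim
    (F : Type*) [Field F] [Fintype F] (q : ℕ)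
    (hcard : Fintype.card F = q) (hq : q % 3 = 1)
    (a b a' b' : Fin 3 → F) (hf : IsFlag a b) (hf' : IsFlag a' b')
    (hdist : ¬ ((∃ s : F, a' = s • a) ∧ (∃ t : F, b' = t • b))) :
    (((∃ s : F, a' = s • a) ∨ (∃ t : F, b' = t • b)) →
      Module.finrank F (Submodule.span F (flagPlane a b ∩ flagPlane a' b')) = 2) ∧
    (¬ ((∃ s : F, a' = s • a) ∨ (∃ t : F, b' = t • b)) →
      (b ⬝ᵥ a' = 0 ∨ b' ⬝ᵥ a = 0) →
      Module.finrank F (Submodule.span F (flagPlane a b ∩ flagPlane a' b')) = 1) ∧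
    (¬ ((∃ s : F, a' = s • a) ∨ (∃ t : F, b' = t • b)) →
      ¬ (b ⬝ᵥ a' = 0 ∨ b' ⬝ᵥ a = 0) →
      Module.finrank F (Submodule.span F (flagPlane a b ∩ flagPlane a' b')) = 0) := by
  refine ⟨?_, ?_, ?_⟩
  · rintro (ha | hb)
    · exact finrank_span_flagPlane_inter_of_smul_left hf hf' ha fun hb => hdist ⟨ha, hb⟩
    · rw [← finrank_span_flagPlane_inter_transpose]
      exact finrank_span_flagPlane_inter_of_smul_left
        ⟨hf.2.1, hf.1, by rw [dotProduct_comm, hf.2.2]⟩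
        ⟨hf'.2.1, hf'.1, by rw [dotProduct_comm, hf'.2.2]⟩ hb fun ha => hdist ⟨ha, hb⟩
  · intro hn h
    obtain ⟨ha, hb⟩ := not_or.mp hn
    rcases h with h | h
    · exact finrank_span_flagPlane_inter_of_dotProduct_eq_zero hf hf' ha hb h
    · rw [Set.inter_comm]
      exact finrank_span_flagPlane_inter_of_dotProduct_eq_zero hf' hf
        (fun h => ha (exists_eq_smul_symm hf.1 h))
        (fun h => hb (exists_eq_smul_symm hf.2.1 h)) h
  · intro _ h
    obtain ⟨hba', hb'a⟩ := not_or.mp h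
    rw [Submodule.span_eq_bot.mpr
      (flagPlane_inter_subset_of_dotProduct_ne_zero hf hf' hba' hb'a), finrank_bot]
end

section
/- Let F be a finite field with q elements, q ≡ 1 (mod 3), and let (a,b) be a flag. The F-linear span of the set of matrices a'·b'ᵀ, where (a',b') ranges over all flags satisfying b·a' = 0 or b'·a = 0, equals the 7-dimensional subspace {M : M is a 3×3 matrix over F, Tr(M) = 0 and bᵀ·M·a = 0} of the space of 3×3 matrices over F. (This expresses that the 2(q+1) lines of the hexagon Γ at distance 1 or 3 from the point x = a·bᵀ span the hyperplane x^⊥.) -/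
open Matrix

/-- A flag `(a, b)` extends to a basis of `F³` with first vector `a` whose dual basis has last
vector `b`; the two bases are the columns of `P` and the rows of `Q`. -/
theorem IsFlag.exists_dual_bases {F : Type*} [Field F] {a b : Fin 3 → F} (hf : IsFlag a b) :
    ∃ P Q : Matrix (Fin 3) (Fin 3) F, Q * P = 1 ∧ P.col 0 = a ∧ Q.row 2 = b := by
  obtain ⟨ha, hb, hab⟩ := hf
  obtain ⟨i, hi⟩ := Function.ne_iff.mp ha
  obtain ⟨j, hj⟩ := Function.ne_iff.mp hb
  obtain ⟨c, hc⟩ : ∃ c, b ⬝ᵥ c = 1 := ⟨Pi.single j (b j)⁻¹, by simpa using mul_inv_cancel₀ hj⟩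
  obtain ⟨d, hda, hdc⟩ : ∃ d, d ⬝ᵥ a = 1 ∧ d ⬝ᵥ c = 0 := by
    have hs : Pi.single i (a i)⁻¹ ⬝ᵥ a = 1 := by simpa using inv_mul_cancel₀ hi
    refine ⟨Pi.single i (a i)⁻¹ - (Pi.single i (a i)⁻¹ ⬝ᵥ c) • b, ?_, ?_⟩
    · rw [sub_dotProduct, smul_dotProduct, hab, hs]; simp
    · rw [sub_dotProduct, smul_dotProduct, hc]; simp
  refine ⟨(of ![a, crossProduct b d, c])ᵀ, of ![d, crossProduct c a, b], ?_, rfl, rfl⟩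
  have hv : crossProduct c a ⬝ᵥ crossProduct b d = 1 := by
    rw [cross_dot_cross, dotProduct_comm c b, dotProduct_comm a d, hc, hda,
      dotProduct_comm c d, hdc]
    simp
  have hcaa : crossProduct c a ⬝ᵥ a = 0 := by rw [dotProduct_comm, dot_cross_self]
  have hcac : crossProduct c a ⬝ᵥ c = 0 := by rw [dotProduct_comm, dot_self_cross]
  ext k l
  change ![d, crossProduct c a, b] k ⬝ᵥ ![a, crossProduct b d, c] l = _
  fin_cases k <;> fin_cases l <;>
    simp [hda, hdc, hv, hcaa, hcac, hab, hc]

/-- The dual pairs `(u, v)` and `(u', v')` of vectors and covectors give the flag `(u + u', v - v')`. -/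
theorem isFlag_add_sub {F : Type*} [Field F] {u u' v v' : Fin 3 → F} (h : v ⬝ᵥ u = 1)
    (h' : v' ⬝ᵥ u' = 1) (huv' : v' ⬝ᵥ u = 0) (hu'v : v ⬝ᵥ u' = 0) : IsFlag (u + u') (v - v') := by
  refine ⟨fun h0 => ?_, fun h0 => ?_, by simp [*]⟩
  · have : v ⬝ᵥ (u + u') = 0 := by rw [h0, dotProduct_zero]
    simp [h, hu'v] at this
  · have : (v - v') ⬝ᵥ u = 0 := by rw [h0, zero_dotProduct]
    simp [h, huv'] at this

theorem near_lines_span_perp_hyperplane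
    (F : Type*) [Field F] [Fintype F] (q : ℕ)
    (hcard : Fintype.card F = q) (hq : q % 3 = 1)
    (a b : Fin 3 → F) (hf : IsFlag a b) :
    (Submodule.span F
        {M : Matrix (Fin 3) (Fin 3) F |
          ∃ a' b' : Fin 3 → F, IsFlag a' b' ∧ (b ⬝ᵥ a' = 0 ∨ b' ⬝ᵥ a = 0) ∧
            M = vecMulVec a' b'} : Set (Matrix (Fin 3) (Fin 3) F))
      = {M : Matrix (Fin 3) (Fin 3) F | Matrix.trace M = 0 ∧ b ⬝ᵥ M.mulVec a = 0} := by
  ext M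
  simp only [SetLike.mem_coe, Set.mem_ofPred_eq]
  constructor
  · intro hM
    induction hM using Submodule.span_induction with
    | mem x hx =>
      obtain ⟨a', b', ⟨-, -, h⟩, h', rfl⟩ := hx
      refine ⟨by rw [trace_vecMulVec, dotProduct_comm, h], ?_⟩
      rw [vecMulVec_mulVec]
      rcases h' with h' | h' <;> simp [h']
    | zero => simp
    | add x y _ _ hx hy => simp [add_mulVec, hx, hy]
    | smul c x _ hx => simp [smul_mulVec, hx]
  · rintro ⟨htr, hbMa⟩
    obtain ⟨P, Q, hQP, rfl, rfl⟩ := hf.exists_dual_bases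
    have hPQ : P * Q = 1 := mul_eq_one_comm.mp hQP
    have hd (i j : Fin 3) : Q.row i ⬝ᵥ P.col j = (1 : Matrix (Fin 3) (Fin 3) F) i j := by
      rw [← hQP]; rfl
    have hP (j : Fin 3) : P.col j ≠ 0 := fun h => by simpa [h] using hd j j
    have hQ (j : Fin 3) : Q.row j ≠ 0 := fun h => by simpa [h] using hd j j
    set S := Submodule.span F {M : Matrix (Fin 3) (Fin 3) F |
          ∃ a' b' : Fin 3 → F, IsFlag a' b' ∧ (Q.row 2 ⬝ᵥ a' = 0 ∨ b' ⬝ᵥ P.col 0 = 0) ∧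
            M = vecMulVec a' b'}
    have hmem {a' b' : Fin 3 → F} (h : IsFlag a' b')
        (h' : Q.row 2 ⬝ᵥ a' = 0 ∨ b' ⬝ᵥ P.col 0 = 0) : vecMulVec a' b' ∈ S :=
      Submodule.subset_span ⟨a', b', h, h', rfl⟩
    have hoff (i j : Fin 3) (hij : j ≠ i) (h : i ≠ 2 ∨ j ≠ 0) :
        vecMulVec (P.col i) (Q.row j) ∈ S := by
      refine hmem ⟨hP i, hQ j, by rw [hd, one_apply_ne hij]⟩ ?_
      rw [hd, hd]
      exact h.imp (fun h => one_apply_ne h.symm) (fun h => one_apply_ne h)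
    have hdiag (i j : Fin 3) (hij : j ≠ i) (hi : i ≠ 2 ∧ j ≠ 2 ∨ i ≠ 0 ∧ j ≠ 0) :
        vecMulVec (P.col i) (Q.row i) - vecMulVec (P.col j) (Q.row j) ∈ S := by
      have hfl : IsFlag (P.col i + P.col j) (Q.row i - Q.row j) :=
        isFlag_add_sub (by simp [hd]) (by simp [hd]) (by simp [hd, hij]) (by simp [hd, hij.symm])
      have h1 : vecMulVec (P.col i + P.col j) (Q.row i - Q.row j) ∈ S := by
        refine hmem hfl (hi.imp (fun h => ?_) fun h => ?_)
        · rw [dotProduct_add, hd, hd, one_apply_ne h.1.symm, one_apply_ne h.2.symm, add_zero]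
        · rw [sub_dotProduct, hd, hd, one_apply_ne h.1, one_apply_ne h.2, sub_zero]
      have h2 := hoff i j hij (by omega)
      have h3 := hoff j i hij.symm (by omega)
      convert S.sub_mem (S.add_mem h1 h2) h3 using 1
      simp only [add_vecMulVec, vecMulVec_sub]
      abel
    set N := Q * M * P with hN
    have hM : M = P * N * Q := by
      rw [hN, show P * (Q * M * P) * Q = (P * Q) * M * (P * Q) by simp only [Matrix.mul_assoc],
        hPQ, Matrix.one_mul, Matrix.mul_one]
    have hN20 : N 2 0 = 0 := by
      rw [hN, Matrix.mul_assoc, ← hbMa]; rfl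
    have hNtr : N 2 2 = - N 0 0 - N 1 1 := by
      have h : N.trace = 0 := by
        rw [hN, trace_mul_comm, ← Matrix.mul_assoc, hPQ, Matrix.one_mul, htr]
      rw [trace_fin_three] at h
      linear_combination h
    have hsum : M = N 0 1 • vecMulVec (P.col 0) (Q.row 1) + N 0 2 • vecMulVec (P.col 0) (Q.row 2)
        + N 1 0 • vecMulVec (P.col 1) (Q.row 0) + N 1 2 • vecMulVec (P.col 1) (Q.row 2)
        + N 2 1 • vecMulVec (P.col 2) (Q.row 1)
        + N 0 0 • (vecMulVec (P.col 0) (Q.row 0) - vecMulVec (P.col 1) (Q.row 1))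
        + (N 0 0 + N 1 1) • (vecMulVec (P.col 1) (Q.row 1) - vecMulVec (P.col 2) (Q.row 2)) := by
      clear_value N
      rw [hM]
      ext i j
      simp only [mul_apply, Fin.sum_univ_three, Matrix.add_apply, Matrix.smul_apply, Matrix.sub_apply,
        vecMulVec_apply, col_apply, row_apply, smul_eq_mul, hN20, hNtr]
      ring
    rw [hsum]
    refine S.add_mem (S.add_mem (S.add_mem (S.add_mem (S.add_mem (S.add_mem ?_ ?_) ?_) ?_) ?_) ?_) ?_
      <;> apply S.smul_mem
    · exact hoff 0 1 (by decide) (by decide)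
    · exact hoff 0 2 (by decide) (by decide)
    · exact hoff 1 0 (by decide) (by decide)
    · exact hoff 1 2 (by decide) (by decide)
    · exact hoff 2 1 (by decide) (by decide)
    · exact hdiag 0 1 (by decide) (by decide)
    · exact hdiag 1 2 (by decide) (by decide)
end

section
/- Let F be a finite field with q elements, q ≡ 1 (mod 3). Let (a,b) and (a',b') be flags. Then b'ᵀ·N·a' = 0 holds for every matrix N ∈ π(a,b) if and only if a' is a scalar multiple of a or b' is a scalar multiple of b. (This expresses that the subspace π_x^⊥ meets the hexagon Γ precisely in the two lines of Γ through the point x = a·bᵀ.) -/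
open Matrix

/-- A vector whose `2 × 2` minors with a nonzero vector `a` vanish is a multiple of `a`. -/
theorem exists_eq_smul_of_minors_eq_zero {F ι : Type*} [Field F] {a v : ι → F} (ha : a ≠ 0)
    (h : ∀ i j, a i * v j = a j * v i) : ∃ s : F, v = s • a := by
  obtain ⟨i, hi⟩ := Function.ne_iff.mp ha
  rw [Pi.zero_apply] at hi
  refine ⟨v i / a i, funext fun j => ?_⟩
  simp only [Pi.smul_apply, smul_eq_mul]
  field_simp
  linear_combination h i j

/-- A vector orthogonal to everything orthogonal to `a` is a multiple of `a`. -/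
theorem exists_eq_smul_of_forall_dotProduct_eq_zero {F ι : Type*} [Field F] [Fintype ι]
    {a v : ι → F} (ha : a ≠ 0) (h : ∀ c : ι → F, c ⬝ᵥ a = 0 → c ⬝ᵥ v = 0) :
    ∃ s : F, v = s • a := by
  classical
  refine exists_eq_smul_of_minors_eq_zero ha fun i j => ?_
  have := h (Pi.single j (a i) - Pi.single i (a j)) (by simp [sub_dotProduct, mul_comm])
  simpa [sub_dotProduct, sub_eq_zero] using this

/-- A vector orthogonal to `a` and `v` is a multiple of `a ⨯₃ v` if the latter is nonzero. -/
theorem exists_eq_smul_cross {F : Type*} [Field F] {a v b : Fin 3 → F}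
    (hu : crossProduct a v ≠ 0) (ha : b ⬝ᵥ a = 0) (hv : b ⬝ᵥ v = 0) :
    ∃ s : F, b = s • crossProduct a v := by
  refine exists_eq_smul_of_minors_eq_zero hu ?_
  simp only [dotProduct, Fin.sum_univ_three] at ha hv
  intro i j
  fin_cases i <;> fin_cases j <;> simp [cross_apply]
  · linear_combination v 2 * ha - a 2 * hv
  · linear_combination a 1 * hv - v 1 * ha
  · linear_combination a 2 * hv - v 2 * ha
  · linear_combination v 0 * ha - a 0 * hv
  · linear_combination v 1 * ha - a 1 * hv
  · linear_combination a 0 * hv - v 0 * ha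

theorem exists_eq_smul_of_cross_eq_zero {F : Type*} [Field F] {a v : Fin 3 → F} (ha : a ≠ 0)
    (h : crossProduct a v = 0) : ∃ s : F, v = s • a := by
  refine exists_eq_smul_of_minors_eq_zero ha ?_
  have h0 := congrFun h 0
  have h1 := congrFun h 1
  have h2 := congrFun h 2
  simp [cross_apply] at h0 h1 h2
  intro i j
  fin_cases i <;> fin_cases j <;> simp <;> grind

theorem dotProduct_mulVec_vecMulVec_add {F ι : Type*} [Field F] [Fintype ι]
    (a b c d v w : ι → F) :
    w ⬝ᵥ (vecMulVec a c + vecMulVec d b).mulVec v =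
      (w ⬝ᵥ a) * (c ⬝ᵥ v) + (w ⬝ᵥ d) * (b ⬝ᵥ v) := by
  simp [add_mulVec, vecMulVec_mulVec, dotProduct_add, mul_comm]

theorem flagPlane_perp_meets_hexagon
    (F : Type*) [Field F] [Fintype F] (q : ℕ)
    (hcard : Fintype.card F = q) (hq : q % 3 = 1)
    (a b a' b' : Fin 3 → F) (hf : IsFlag a b) (hf' : IsFlag a' b') :
    (∀ N ∈ flagPlane a b, b' ⬝ᵥ N.mulVec a' = 0) ↔
      (∃ s : F, a' = s • a) ∨ (∃ t : F, b' = t • b) := by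
  obtain ⟨ha, hb, hba⟩ := hf
  obtain ⟨-, -, hba'⟩ := hf'
  constructor
  · intro h
    have key (c d : Fin 3 → F) (hc : c ⬝ᵥ a = 0) (hd : d ⬝ᵥ b = 0) :
        (b' ⬝ᵥ a) * (c ⬝ᵥ a') + (b' ⬝ᵥ d) * (b ⬝ᵥ a') = 0 := by
      rw [← dotProduct_mulVec_vecMulVec_add]
      exact h _ ⟨c, d, hc, hd, rfl⟩
    by_contra! hne
    obtain ⟨hna, hnb⟩ := hne
    have h1 : b' ⬝ᵥ a = 0 := by
      by_contra h0
      obtain ⟨s, hs⟩ := exists_eq_smul_of_forall_dotProduct_eq_zero (v := a') ha fun c hc => by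
        simpa [h0] using key c 0 hc (zero_dotProduct b)
      exact hna s hs
    have h2 : b ⬝ᵥ a' = 0 := by
      by_contra h0
      obtain ⟨t, ht⟩ := exists_eq_smul_of_forall_dotProduct_eq_zero (v := b') hb fun d hd => by
        simpa [h0, dotProduct_comm] using key 0 d (zero_dotProduct a) hd
      exact hnb t ht
    have hu : crossProduct a a' ≠ 0 := fun h0 => by
      obtain ⟨s, hs⟩ := exists_eq_smul_of_cross_eq_zero ha h0
      exact hna s hs
    obtain ⟨s, hs⟩ := exists_eq_smul_cross hu hba h2
    obtain ⟨t, ht⟩ := exists_eq_smul_cross hu h1 hba'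
    have hs0 : s ≠ 0 := by
      rintro rfl
      exact hb (by simpa using hs)
    refine hnb (t / s) ?_
    rw [hs, smul_smul, div_mul_cancel₀ t hs0]
    exact ht
  · rintro h N ⟨c, d, hc, hd, rfl⟩
    rw [dotProduct_mulVec_vecMulVec_add]
    rcases h with ⟨s, rfl⟩ | ⟨t, rfl⟩
    · simp [hc, hba]
    · simp [hba, dotProduct_comm b d, hd]
end

section
/- Let F be a finite field with q elements, q ≡ 1 (mod 3). The number of nonzero 3×3 matrices M over F with Tr(M) = 0, Q(M) = 0 and det(M) = 0 equals (q−1)(q²+q+1)(q³+1). (Equivalently, the set O has exactly (q²+q+1)(q³+1) projective points, the correct size of a (q²+q+1)-ovoid of Q⁺(7,q).) -/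
/-- The quadratic form `Q` on 3×3 matrices whose zero locus (together with trace zero)
defines the hyperbolic quadric `Q⁺(7,q)`. -/
def quadForm {F : Type*} [Field F] (M : Matrix (Fin 3) (Fin 3) F) : F :=
  M 0 1 * M 1 0 + M 0 2 * M 2 0 + M 1 2 * M 2 1
    - M 0 0 * M 1 1 - M 0 0 * M 2 2 - M 1 1 * M 2 2

/-- The 3×3 matrices whose characteristic polynomial is `X ^ 3`. -/
def nilpotentLocus (F : Type*) [Field F] : Set (Matrix (Fin 3) (Fin 3) F) :=
  {M | Matrix.trace M = 0 ∧ quadForm M = 0 ∧ M.det = 0}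

/-- The members of `nilpotentLocus F` with prescribed first column below the diagonal. -/
def nilpotentFiber (F : Type*) [Field F] (d g : F) : Set (Matrix (Fin 3) (Fin 3) F) :=
  {M | M ∈ nilpotentLocus F ∧ M 1 0 = d ∧ M 2 0 = g}

theorem mem_nilpotentLocus_iff {F : Type*} [Field F] {M : Matrix (Fin 3) (Fin 3) F} :
    M ∈ nilpotentLocus F ↔ M 0 0 + M 1 1 + M 2 2 = 0 ∧
      M 0 1 * M 1 0 + M 0 2 * M 2 0 + M 1 2 * M 2 1
        - M 0 0 * M 1 1 - M 0 0 * M 2 2 - M 1 1 * M 2 2 = 0 ∧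
      M 0 0 * M 1 1 * M 2 2 - M 0 0 * M 1 2 * M 2 1
        - M 0 1 * M 1 0 * M 2 2 + M 0 1 * M 1 2 * M 2 0
        + M 0 2 * M 1 0 * M 2 1 - M 0 2 * M 1 1 * M 2 0 = 0 := by
  simp only [nilpotentLocus, Set.mem_ofPred_eq, Matrix.trace_fin_three, quadForm,
    Matrix.det_fin_three]

theorem ncard_eq_card_pow_four_of_invOn {F α : Type*} [Fintype F] {s : Set α}
    {p : α → F × F × F × F} {m : F × F × F × F → α}
    (hm : ∀ x, m x ∈ s) (hpm : ∀ x, p (m x) = x) (hmp : ∀ y ∈ s, m (p y) = y) :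
    s.ncard = Fintype.card F ^ 4 := by
  have e : s ≃ F × F × F × F :=
    ⟨fun y => p y, fun x => ⟨m x, hm x⟩, fun y => Subtype.ext (hmp y y.2), hpm⟩
  rw [← Nat.card_coe_set_eq, Nat.card_congr e]
  simp only [Nat.card_eq_fintype_card, Fintype.card_prod]
  ring

theorem ncard_nilpotentFiber_zero_zero {F : Type*} [Field F] [Fintype F] :
    (nilpotentFiber F 0 0).ncard = Fintype.card F ^ 4 := by
  classical
  refine ncard_eq_card_pow_four_of_invOn
    (p := fun M => (M 0 1, M 0 2, M 1 2, if M 1 2 = 0 then M 2 1 else M 1 1))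
    (m := fun ⟨b, c, f, x⟩ => if f = 0 then !![0, b, c; 0, 0, f; 0, x, 0]
      else !![0, b, c; 0, x, f; 0, -x ^ 2 / f, -x]) ?_ ?_ ?_
  · rintro ⟨b, c, f, x⟩
    by_cases hf : f = 0
    · simp [hf, nilpotentFiber, mem_nilpotentLocus_iff]
    · simp [hf, nilpotentFiber, mem_nilpotentLocus_iff]
      field_simp
      ring
  · rintro ⟨b, c, f, x⟩
    by_cases hf : f = 0 <;> simp [hf]
  · rintro M ⟨hM, hd, hg⟩
    obtain ⟨ht, hq, hdet⟩ := mem_nilpotentLocus_iff.1 hM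
    rw [hd, hg] at hq hdet
    have ha : M 0 0 = 0 := by
      refine pow_eq_zero_iff (n := 3) (by norm_num) |>.1 ?_
      linear_combination hdet + M 0 0 * hq + M 0 0 ^ 2 * ht
    have hi : M 2 2 = -M 1 1 := by linear_combination ht - ha
    have he : M 1 1 ^ 2 = -(M 1 2 * M 2 1) := by
      rw [ha, hi] at hq
      linear_combination hq
    by_cases hf : M 1 2 = 0
    · have he0 : M 1 1 = 0 := by simpa [hf] using he
      ext i j
      fin_cases i <;> fin_cases j <;> simp [hf, ha, hi, he0, hd, hg]
    · ext i j
      fin_cases i <;> fin_cases j <;> simp [hf, ha, hi, he, hd, hg]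

/-- For `g ≠ 0`, the fiber is parametrised by `M 0 0`, `M 2 1`, the minor `k` of the lower
first column `u` against its image under the lower right block, and one further entry. -/
theorem ncard_nilpotentFiber_of_ne_zero {F : Type*} [Field F] [Fintype F] {d g : F}
    (hg0 : g ≠ 0) : (nilpotentFiber F d g).ncard = Fintype.card F ^ 4 := by
  classical
  let minor (M : Matrix (Fin 3) (Fin 3) F) : F :=
    M 1 2 * g ^ 2 + d * g * (M 1 1 - M 2 2) - d ^ 2 * M 2 1
  let f (k a e h : F) : F := (k - d * g * (e - (-a - e)) + d ^ 2 * h) / g ^ 2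
  let r (k a e h : F) : F := a * e + a * (-a - e) + e * (-a - e) - f k a e h * h
  let b (k a e h : F) : F :=
    -(a * g * (e * (-a - e) - f k a e h * h) + r k a e h * (d * h - e * g)) / k
  let mat (k a e h b : F) : Matrix (Fin 3) (Fin 3) F :=
    !![a, b, (r k a e h - b * d) / g; d, e, f k a e h; g, h, -a - e]
  have hmat {M : Matrix (Fin 3) (Fin 3) F} (hM : M ∈ nilpotentFiber F d g) :
      mat (minor M) (M 0 0) (M 1 1) (M 2 1) (M 0 1) = M := by
    obtain ⟨hM, hd, hg⟩ := hM
    obtain ⟨ht, hq, -⟩ := mem_nilpotentLocus_iff.1 hM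
    rw [hd, hg] at hq
    have hi : M 2 2 = -M 0 0 - M 1 1 := by linear_combination ht
    have hf : f (minor M) (M 0 0) (M 1 1) (M 2 1) = M 1 2 := by
      simp only [f, minor, hi]
      field_simp
      ring
    have hc : (r (minor M) (M 0 0) (M 1 1) (M 2 1) - M 0 1 * d) / g = M 0 2 := by
      rw [div_eq_iff hg0]
      simp only [r, hf]
      rw [hi] at hq
      linear_combination -hq
    ext i j
    fin_cases i <;> fin_cases j <;> simp [mat, hf, hc, hd, hg, hi]
  have hminor (k a e h b : F) : minor (mat k a e h b) = k := by
    simp [minor, mat, f]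
    field_simp
    ring
  refine ncard_eq_card_pow_four_of_invOn
    (p := fun M => (minor M, M 0 0, M 2 1, if minor M = 0 then M 0 1 else M 1 1))
    (m := fun ⟨k, a, h, x⟩ => if k = 0 then mat 0 a (h * d / g) h x
      else mat k a x h (b k a x h)) ?_ ?_ ?_
  · rintro ⟨k, a, h, x⟩
    by_cases hk : k = 0
    · simp [hk, nilpotentFiber, mem_nilpotentLocus_iff, mat, r, f]
      constructor <;> field_simp <;> ring
    · simp [hk, nilpotentFiber, mem_nilpotentLocus_iff, mat, b, r, f]
      constructor <;> field_simp <;> ring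
  · rintro ⟨k, a, h, x⟩
    by_cases hk : k = 0
    · simp only [hk, if_true, hminor]
      simp [mat]
    · simp only [hk, if_false, hminor]
      simp [mat]
  · intro M hM
    have hMM := hmat hM
    obtain ⟨hM, hd, hg⟩ := hM
    obtain ⟨ht, hq, hdet⟩ := mem_nilpotentLocus_iff.1 hM
    rw [hd, hg] at hq hdet
    have hi : M 2 2 = -M 0 0 - M 1 1 := by linear_combination ht
    by_cases hk : minor M = 0
    · have he : M 2 1 * d / g = M 1 1 := by
        have hw : (d * M 2 1 - M 1 1 * g) ^ 3 = 0 := by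
          simp only [minor] at hk
          rw [hi] at hk hq hdet
          linear_combination -g ^ 3 * hdet + g ^ 2 * (d * M 2 1 - M 1 1 * g) * hq +
            (g ^ 2 * M 0 1 - M 2 1 * (M 0 0 * g + (d * M 2 1 - M 1 1 * g))) * hk
        have := pow_eq_zero_iff (n := 3) (by norm_num) |>.1 hw
        rw [div_eq_iff hg0]
        linear_combination this
      simp only [hk, if_true, he]
      rwa [hk] at hMM
    · have hb : b (minor M) (M 0 0) (M 1 1) (M 2 1) = M 0 1 := by
        have hf : f (minor M) (M 0 0) (M 1 1) (M 2 1) = M 1 2 := congr_fun₂ hMM 1 2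
        simp only [b, r, hf]
        rw [div_eq_iff hk]
        simp only [minor]
        rw [hi] at hq hdet ⊢
        linear_combination -g * hdet + (d * M 2 1 - M 1 1 * g) * hq
      simp only [hk, if_false, hb]
      exact hMM

theorem ncard_nilpotentFiber_swap {F : Type*} [Field F] (d g : F) :
    (nilpotentFiber F d g).ncard = (nilpotentFiber F g d).ncard := by
  let σ : Equiv.Perm (Fin 3) := Equiv.swap 1 2
  have h0 : σ 0 = 0 := by decide
  have h1 : σ 1 = 2 := by decide
  have h2 : σ 2 = 1 := by decide
  have hmem {d g : F} {M : Matrix (Fin 3) (Fin 3) F} (hM : M ∈ nilpotentFiber F d g) :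
      M.submatrix σ σ ∈ nilpotentFiber F g d := by
    obtain ⟨hM, hd, hg⟩ := hM
    obtain ⟨ht, hq, hdet⟩ := mem_nilpotentLocus_iff.1 hM
    refine ⟨mem_nilpotentLocus_iff.2 ?_, by simpa [h0, h1], by simpa [h0, h2]⟩
    simp only [Matrix.submatrix_apply, h0, h1, h2]
    exact ⟨by linear_combination ht, by linear_combination hq, by linear_combination hdet⟩
  have hinv (M : Matrix (Fin 3) (Fin 3) F) : (M.submatrix σ σ).submatrix σ σ = M := by
    ext i j
    simp [σ]
  exact Set.ncard_congr' ⟨fun M => ⟨_, hmem M.2⟩, fun M => ⟨_, hmem M.2⟩,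
    fun M => Subtype.ext (hinv M), fun M => Subtype.ext (hinv M)⟩

theorem ncard_nilpotentFiber {F : Type*} [Field F] [Fintype F] (d g : F) :
    (nilpotentFiber F d g).ncard = Fintype.card F ^ 4 := by
  by_cases hg : g = 0
  · by_cases hd : d = 0
    · rw [hd, hg, ncard_nilpotentFiber_zero_zero]
    · rw [ncard_nilpotentFiber_swap, ncard_nilpotentFiber_of_ne_zero hd]
  · exact ncard_nilpotentFiber_of_ne_zero hg

theorem ncard_nilpotentLocus (F : Type*) [Field F] [Fintype F] :
    (nilpotentLocus F).ncard = Fintype.card F ^ 6 := by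
  classical
  rw [Set.ncard_eq_toFinset_card', Finset.card_eq_sum_card_fiberwise
    (f := fun M => (M 1 0, M 2 0)) (t := Finset.univ) (fun _ _ => Finset.mem_univ _)]
  have hfiber (x : F × F) :
      ((nilpotentLocus F).toFinset.filter fun M => (M 1 0, M 2 0) = x).card
        = Fintype.card F ^ 4 := by
    rw [← ncard_nilpotentFiber x.1 x.2, ← Set.ncard_coe_finset]
    congr 1
    ext M
    simp [nilpotentFiber, Prod.ext_iff]
  simp only [hfiber, Finset.sum_const, Finset.card_univ, Fintype.card_prod, smul_eq_mul]
  ring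

theorem ovoid_size
    (F : Type*) [Field F] [Fintype F] (q : ℕ)
    (hcard : Fintype.card F = q) (hq : q % 3 = 1) :
    {M : Matrix (Fin 3) (Fin 3) F | M ≠ 0 ∧ Matrix.trace M = 0 ∧
        quadForm M = 0 ∧ M.det = 0}.ncard
      = (q - 1) * (q ^ 2 + q + 1) * (q ^ 3 + 1) := by
  have hset : {M : Matrix (Fin 3) (Fin 3) F | M ≠ 0 ∧ Matrix.trace M = 0 ∧
      quadForm M = 0 ∧ M.det = 0} = nilpotentLocus F \ {0} := by
    ext M
    simp only [nilpotentLocus, Set.mem_ofPred_eq, Set.mem_sdiff, Set.mem_singleton_iff]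
    tauto
  have hzero : (0 : Matrix (Fin 3) (Fin 3) F) ∈ nilpotentLocus F := by
    simp [mem_nilpotentLocus_iff]
  rw [hset, Set.ncard_sdiff_singleton_of_mem hzero, ncard_nilpotentLocus, hcard]
  obtain ⟨n, rfl⟩ : ∃ n, q = n + 1 := ⟨q - 1, by lia⟩
  rw [Nat.add_sub_cancel]
  apply Nat.sub_eq_of_eq_add
  ring
end

section
/- Let F be a finite field with q elements, q ≡ 1 (mod 3). For every nonzero 3×3 matrix M over F with Tr(M) = 0 and Q(M) = 0, the number of nonzero 3×3 matrices N over F satisfying Tr(N) = 0, Q(N) = 0, det(N) = 0 and Tr(M·N) = 0 equals (q−1)(q⁴+q³+q²+q+1) if det(M) = 0, and equals (q−1)(q²+1)(q²+q+1) if det(M) ≠ 0. (Equivalently, the set O is a (q²+q+1)-ovoid of the hyperbolic quadric Q⁺(7,q): every point P of Q⁺(7,q) satisfies |P^⊥ ∩ O| = (q²+q+1)(q²+1) − q² if P ∈ O and |P^⊥ ∩ O| = (q²+q+1)(q²+1) if P ∉ O.) -/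
section

open Matrix Finset
open scoped Classical

/-- The nonzero vectors in the kernel of `A`. -/
noncomputable def kerVectors {F : Type*} [Field F] [Fintype F]
    (A : Matrix (Fin 3) (Fin 3) F) : Finset (Fin 3 → F) :=
  {x | x ≠ 0 ∧ A *ᵥ x = 0}

/-- The nonzero vectors `x` such that the line spanned by `x` contains the image of `A`. -/
noncomputable def imVectors {F : Type*} [Field F] [Fintype F]
    (A : Matrix (Fin 3) (Fin 3) F) : Finset (Fin 3 → F) :=
  {x | x ≠ 0 ∧ ∃ y, A = vecMulVec x y}

/-- The matrices `N` with characteristic polynomial `X ^ 3` such that `Tr (M * N) = 0`. -/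
noncomputable def nilpotentPerp {F : Type*} [Field F] [Fintype F]
    (M : Matrix (Fin 3) (Fin 3) F) : Finset (Matrix (Fin 3) (Fin 3) F) :=
  {N | trace N = 0 ∧ quadForm N = 0 ∧ N.det = 0 ∧ trace (M * N) = 0}

section

variable {F : Type*} [Field F]

lemma exists_eq_vecMulVec_of_rank_le_one {A : Matrix (Fin 3) (Fin 3) F} (h : A.rank ≤ 1) :
    ∃ x y, A = vecMulVec x y := by
  obtain ⟨⟨x, hx⟩, h⟩ := finrank_le_one_iff.mp h
  choose c hc using h
  refine ⟨x, fun j => c ⟨A *ᵥ Pi.single j 1, ⟨_, rfl⟩⟩, ?_⟩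
  ext i j
  have := congrArg (fun v => v.1 i) (hc ⟨A *ᵥ Pi.single j 1, ⟨_, rfl⟩⟩)
  rw [vecMulVec_apply, mul_comm]
  simpa using this.symm

lemma exists_unit_mulVec_single {x : Fin 3 → F} (hx : x ≠ 0) :
    ∃ g : (Matrix (Fin 3) (Fin 3) F)ˣ, g.1 *ᵥ Pi.single 0 1 = x := by
  have key : ∀ A : Matrix (Fin 3) (Fin 3) F, A.det ≠ 0 → A.col 0 = x →
      ∃ g : (Matrix (Fin 3) (Fin 3) F)ˣ, g.1 *ᵥ Pi.single 0 1 = x := by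
    intro A hA h
    obtain ⟨g, rfl⟩ := (isUnit_iff_isUnit_det A).mpr hA.isUnit
    exact ⟨g, by rw [mulVec_single_one, h]⟩
  obtain ⟨i, hi⟩ := Function.ne_iff.mp hx
  fin_cases i
  · refine key !![x 0, 0, 0; x 1, 1, 0; x 2, 0, 1] ?_ ?_
    · simpa [det_fin_three] using hi
    · ext i; fin_cases i <;> rfl
  · refine key !![x 0, 1, 0; x 1, 0, 0; x 2, 0, 1] ?_ ?_
    · simpa [det_fin_three] using hi
    · ext i; fin_cases i <;> rfl
  · refine key !![x 0, 1, 0; x 1, 0, 1; x 2, 0, 0] ?_ ?_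
    · simpa [det_fin_three] using hi
    · ext i; fin_cases i <;> rfl

lemma quadForm_eq_neg_trace_adjugate (A : Matrix (Fin 3) (Fin 3) F) :
    quadForm A = -trace A.adjugate := by
  simp [quadForm, adjugate_fin_three, trace_fin_three]
  ring

lemma quadForm_units_conj (g : (Matrix (Fin 3) (Fin 3) F)ˣ) (A : Matrix (Fin 3) (Fin 3) F) :
    quadForm (g⁻¹.1 * A * g.1) = quadForm A := by
  rw [quadForm_eq_neg_trace_adjugate, quadForm_eq_neg_trace_adjugate, adjugate_mul_distrib,
    adjugate_mul_distrib, trace_mul_comm, mul_assoc, ← adjugate_mul_distrib]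
  simp

variable [Fintype F]

lemma card_kerVectors_add_one (A : Matrix (Fin 3) (Fin 3) F) :
    #(kerVectors A) + 1 = Fintype.card F ^ (3 - A.rank) := by
  have h1 := LinearMap.finrank_range_add_finrank_ker A.mulVecLin
  have h2 := Module.card_eq_pow_finrank (K := F) (V := LinearMap.ker A.mulVecLin)
  have h3 : Module.finrank F (LinearMap.ker A.mulVecLin) = 3 - A.rank := by
    simp only [Module.finrank_fintype_fun_eq_card, Fintype.card_fin] at h1
    unfold Matrix.rank
    omega
  rw [← h3, ← h2]
  have h4 : kerVectors A = ({x | A *ᵥ x = 0} : Finset _).erase 0 := by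
    ext x; simp [kerVectors]
  rw [h4, card_erase_add_one (by simp), Fintype.card_subtype]
  simp

lemma card_imVectors_of_ne_zero {x y : Fin 3 → F} (hx : x ≠ 0) (hy : y ≠ 0) :
    #(imVectors (vecMulVec x y)) = Fintype.card F - 1 := by
  obtain ⟨j, hj⟩ := Function.ne_iff.mp hy
  obtain ⟨i, hi⟩ := Function.ne_iff.mp hx
  rw [← Fintype.card_units, ← card_univ]
  symm
  refine card_bij (fun c _ => (c : F) • x) ?_ ?_ ?_
  · intro c _
    simp only [imVectors, mem_filter, mem_univ, true_and]
    refine ⟨smul_ne_zero c.ne_zero hx, (c⁻¹ : F) • y, ?_⟩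
    ext a b
    simp only [vecMulVec_apply, Pi.smul_apply, smul_eq_mul]
    field_simp
  · intro c _ d _ h
    have := congrFun h i
    exact Units.ext (mul_right_cancel₀ hi this)
  · intro z hz
    simp only [imVectors, mem_filter, mem_univ, true_and] at hz
    obtain ⟨hz, w, hw⟩ := hz
    have h : ∀ a, x a * y j = z a * w j := fun a => congrFun (congrFun hw a) j
    have hwj : w j ≠ 0 := by
      intro h0
      have := h i
      rw [h0, mul_zero] at this
      exact (mul_ne_zero hi hj) this
    refine ⟨Units.mk0 (y j / w j) (div_ne_zero hj hwj), mem_univ _, ?_⟩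
    ext a
    have := h a
    simp only [Units.val_mk0, Pi.smul_apply, smul_eq_mul]
    field_simp
    linear_combination this

lemma card_kerVectors {A : Matrix (Fin 3) (Fin 3) F} (hA : A ≠ 0) (hdet : A.det = 0) :
    (#(kerVectors A) : ℤ) = Fintype.card F - 1 + Fintype.card F * #(imVectors A) := by
  have hk := card_kerVectors_add_one A
  have hq : 1 ≤ Fintype.card F := Fintype.card_pos
  have h3 : A.rank ≠ 3 := by
    intro h
    have h' : LinearMap.range A.mulVecLin = ⊤ :=
      Submodule.eq_top_of_finrank_eq (by simpa [Matrix.rank] using h)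
    have : IsUnit A := by
      rw [← mulVec_surjective_iff_isUnit]
      exact LinearMap.range_eq_top.mp h'
    rw [isUnit_iff_isUnit_det, hdet] at this
    exact not_isUnit_zero this
  have h3' : A.rank ≤ 3 := by simpa using A.rank_le_card_width
  by_cases h1 : A.rank ≤ 1
  · obtain ⟨x, y, rfl⟩ := exists_eq_vecMulVec_of_rank_le_one h1
    have hx : x ≠ 0 := by rintro rfl; exact hA (by ext; simp [vecMulVec_apply])
    have hy : y ≠ 0 := by rintro rfl; exact hA (by ext; simp [vecMulVec_apply])
    have h0 : (vecMulVec x y).rank ≠ 0 := by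
      intro h
      rw [Matrix.rank, Submodule.finrank_eq_zero, LinearMap.range_eq_bot] at h
      exact hA (by
        rw [← Matrix.mulVecLin_zero] at h
        exact Matrix.mulVec_injective (congrArg DFunLike.coe h))
    have h2 : (vecMulVec x y).rank = 1 := by omega
    rw [card_imVectors_of_ne_zero hx hy]
    rw [h2] at hk
    zify [hq] at hk ⊢
    norm_num at hk
    linear_combination hk
  · have h2 : A.rank = 2 := by omega
    have him : imVectors A = ∅ := by
      rw [imVectors, filter_eq_empty_iff]
      rintro x - ⟨-, y, rfl⟩
      exact h1 (rank_vecMulVec_le x y)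
    rw [h2] at hk
    rw [him]
    zify at hk
    norm_num at hk
    rw [← hk]; simp

end
section

variable {F : Type*} [Field F]

lemma exists_conj_eq_vecMulVec {N : Matrix (Fin 3) (Fin 3) F}
    (g : (Matrix (Fin 3) (Fin 3) F)ˣ) (x : Fin 3 → F) :
    (∃ y, g⁻¹.1 * N * g.1 = vecMulVec x y) ↔ ∃ y, N = vecMulVec (g.1 *ᵥ x) y := by
  constructor
  · rintro ⟨y, hy⟩
    refine ⟨y ᵥ* g⁻¹.1, ?_⟩
    rw [← mul_vecMulVec, ← vecMulVec_mul, ← hy]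
    simp [mul_assoc]
  · rintro ⟨y, rfl⟩
    refine ⟨y ᵥ* g.1, ?_⟩
    rw [mul_vecMulVec, vecMulVec_mul]
    simp

variable [Fintype F]

lemma mem_nilpotentPerp {M N : Matrix (Fin 3) (Fin 3) F} :
    N ∈ nilpotentPerp M ↔
      trace N = 0 ∧ quadForm N = 0 ∧ N.det = 0 ∧ trace (M * N) = 0 := by
  simp [nilpotentPerp]

lemma conj_mem_nilpotentPerp {M N : Matrix (Fin 3) (Fin 3) F}
    (g : (Matrix (Fin 3) (Fin 3) F)ˣ) (hN : N ∈ nilpotentPerp M) :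
    g⁻¹.1 * N * g.1 ∈ nilpotentPerp (g⁻¹.1 * M * g.1) := by
  rw [mem_nilpotentPerp] at hN ⊢
  obtain ⟨h1, h2, h3, h4⟩ := hN
  refine ⟨by rw [trace_units_conj', h1], by rw [quadForm_units_conj, h2],
    by rw [det_units_conj', h3], ?_⟩
  have : g⁻¹.1 * M * g.1 * (g⁻¹.1 * N * g.1) = g⁻¹.1 * (M * N) * g.1 := by
    simp [mul_assoc]
  rw [this, trace_units_conj', h4]

lemma card_filter_ker_conj (M : Matrix (Fin 3) (Fin 3) F) (g : (Matrix (Fin 3) (Fin 3) F)ˣ)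
    (x : Fin 3 → F) :
    #{N ∈ nilpotentPerp M | N *ᵥ (g.1 *ᵥ x) = 0} =
      #{N ∈ nilpotentPerp (g⁻¹.1 * M * g.1) | N *ᵥ x = 0} := by
  refine card_nbij' (fun N => g⁻¹.1 * N * g.1) (fun N => g.1 * N * g⁻¹.1) ?_ ?_ ?_ ?_
  · intro N hN
    simp only [coe_filter, Set.mem_ofPred_eq] at hN ⊢
    refine ⟨conj_mem_nilpotentPerp g hN.1, ?_⟩
    rw [← mulVec_mulVec, ← mulVec_mulVec, hN.2, mulVec_zero]
  · intro N hN
    simp only [coe_filter, Set.mem_ofPred_eq] at hN ⊢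
    refine ⟨by simpa [mul_assoc] using conj_mem_nilpotentPerp g⁻¹ hN.1, ?_⟩
    rw [mulVec_mulVec, mul_assoc, Units.inv_mul, mul_one, ← mulVec_mulVec, hN.2, mulVec_zero]
  · intro N _; simp [mul_assoc]
  · intro N _; simp [mul_assoc]

lemma card_filter_im_conj (M : Matrix (Fin 3) (Fin 3) F) (g : (Matrix (Fin 3) (Fin 3) F)ˣ)
    (x : Fin 3 → F) :
    #{N ∈ nilpotentPerp M | ∃ y, N = vecMulVec (g.1 *ᵥ x) y} =
      #{N ∈ nilpotentPerp (g⁻¹.1 * M * g.1) | ∃ y, N = vecMulVec x y} := by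
  refine card_nbij' (fun N => g⁻¹.1 * N * g.1) (fun N => g.1 * N * g⁻¹.1) ?_ ?_ ?_ ?_
  · intro N hN
    simp only [coe_filter, Set.mem_ofPred_eq] at hN ⊢
    exact ⟨conj_mem_nilpotentPerp g hN.1, (exists_conj_eq_vecMulVec g x).mpr hN.2⟩
  · intro N hN
    simp only [coe_filter, Set.mem_ofPred_eq] at hN ⊢
    refine ⟨by simpa [mul_assoc] using conj_mem_nilpotentPerp g⁻¹ hN.1, ?_⟩
    rw [← exists_conj_eq_vecMulVec]
    simpa [mul_assoc] using hN.2
  · intro N _; simp [mul_assoc]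
  · intro N _; simp [mul_assoc]

lemma card_linear_eq {u v : F} (h : ¬(u = 0 ∧ v = 0)) (r : F) :
    #{p : F × F | u * p.1 + v * p.2 = r} = Fintype.card F := by
  rw [← card_univ]
  by_cases hu : u = 0
  · have hv : v ≠ 0 := fun hv => h ⟨hu, hv⟩
    refine card_nbij' Prod.fst (fun a => (a, r / v)) ?_ ?_ ?_ ?_
    · intro p _; simp
    · intro a _; simp [hu]; field_simp
    · rintro ⟨a, b⟩ hp
      simp [hu] at hp ⊢
      rw [← hp]; field_simp
    · intro a _; rfl
  · refine card_nbij' Prod.snd (fun a => ((r - v * a) / u, a)) ?_ ?_ ?_ ?_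
    · intro p _; simp
    · intro a _; simp; field_simp; ring
    · rintro ⟨a, b⟩ hp
      simp at hp ⊢
      rw [← hp]; field_simp; ring
    · intro a _; rfl

/-- The points of the affine cone `b ^ 2 + c * d = 0` on the plane `α * b + γ * c + δ * d = 0`. -/
noncomputable def coneSection (α γ δ : F) : Finset (F × F × F) :=
  {p | p.1 ^ 2 + p.2.1 * p.2.2 = 0 ∧ α * p.1 + γ * p.2.1 + δ * p.2.2 = 0}

lemma card_coneSection (α γ δ : F) :
    #(coneSection α γ δ) =
      (Fintype.card F - 1) * #{s : F | δ * s ^ 2 - α * s - γ = 0} + #{d : F | δ * d = 0} := by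
  have h1 : #{p ∈ coneSection α γ δ | p.2.1 ≠ 0} =
      (Fintype.card F - 1) * #{s : F | δ * s ^ 2 - α * s - γ = 0} := by
    rw [← Fintype.card_units, ← card_univ, ← card_product]
    symm
    refine card_bij (fun p _ => ((p.1 : F) * p.2, (p.1 : F), -(p.1 : F) * p.2 ^ 2)) ?_ ?_ ?_
    · rintro ⟨c, s⟩ h
      simp [coneSection] at h ⊢
      exact ⟨by ring, by linear_combination (-c : F) * h⟩
    · rintro ⟨c, s⟩ _ ⟨c', s'⟩ _ h
      simp at h
      obtain ⟨h1, h2, -⟩ := h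
      obtain rfl := Units.ext h2
      simpa using h1
    · rintro ⟨b, c, d⟩ h
      simp [coneSection] at h
      obtain ⟨⟨h1, h2⟩, hc⟩ := h
      have hd : d = - b ^ 2 / c := by
        field_simp
        linear_combination h1
      subst hd
      refine ⟨(Units.mk0 c hc, b / c), ?_, ?_⟩
      · simp
        field_simp at h2 ⊢
        linear_combination -h2
      · simp
        constructor <;> field_simp
  have h2 : #{p ∈ coneSection α γ δ | ¬ p.2.1 ≠ 0} = #{d : F | δ * d = 0} := by
    refine card_nbij' (fun p => p.2.2) (fun d => (0, 0, d)) ?_ ?_ ?_ ?_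
    · rintro ⟨b, c, d⟩ h
      simp [coneSection] at h ⊢
      obtain ⟨⟨h1, h2⟩, rfl⟩ := h
      have : b = 0 := by simpa using h1
      simpa [this] using h2
    · intro d h
      simpa [coneSection] using h
    · rintro ⟨b, c, d⟩ h
      simp [coneSection] at h ⊢
      obtain ⟨⟨h1, h2⟩, rfl⟩ := h
      exact ⟨(by simpa using h1 : b = 0).symm, rfl⟩
    · intro d _; rfl
  rw [← h1, ← h2, card_filter_add_card_filter_not]

lemma card_coneSection_zero : #(coneSection (0 : F) 0 0) = Fintype.card F ^ 2 := by
  have hq : 1 ≤ Fintype.card F := Fintype.card_pos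
  rw [card_coneSection]
  simp
  zify [hq]
  ring

end

section

variable {F : Type*} [Field F]

lemma exists_sq_add_self_add_one_eq_zero [Fintype F] (hq : Fintype.card F % 3 = 1) :
    ∃ ω : F, ω ^ 2 + ω + 1 = 0 ∧ 2 * ω + 1 ≠ 0 := by
  have hd : 3 ∣ Fintype.card Fˣ := by
    rw [Fintype.card_units]
    omega
  have : Fact (Nat.Prime 3) := ⟨Nat.prime_three⟩
  obtain ⟨w, hw⟩ := exists_prime_orderOf_dvd_card 3 hd
  have h3 : (w : F) ^ 3 = 1 := by
    have := pow_orderOf_eq_one w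
    rw [hw] at this
    simpa using congrArg Units.val this
  have h1 : (w : F) - 1 ≠ 0 := by
    intro h
    have : w = 1 := Units.ext (by simpa [sub_eq_zero] using h)
    rw [this, orderOf_one] at hw
    omega
  have h0 : (w : F) ^ 2 + w + 1 = 0 := by
    apply mul_left_cancel₀ h1
    linear_combination h3
  refine ⟨w, h0, fun h => h1 ?_⟩
  linear_combination (w : F) * (4 * h0 - (2 * w + 1) * h) - h

/-- The plane section of the cone attached to `!![a, δ; γ, d]` is a pair of lines when the
eigenvalues of that matrix are `l * ω` and `l * ω ^ 2` with `l ≠ 0`. -/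
lemma card_coneSection_of_ne_zero [Fintype F] (hq : Fintype.card F % 3 = 1) {l a d γ δ : F}
    (hl : l ≠ 0) (htr : l + a + d = 0) (hdet : a * d - γ * δ = l ^ 2) :
    (#(coneSection (a - d) γ δ) : ℤ) = 2 * Fintype.card F - 1 := by
  have hq1 : 1 ≤ Fintype.card F := Fintype.card_pos
  obtain ⟨ω, hω, hω'⟩ := exists_sq_add_self_add_one_eq_zero hq
  rw [card_coneSection]
  obtain rfl : d = -l - a := by linear_combination htr
  by_cases hδ : δ = 0
  · subst hδ
    have hα : a - (-l - a) ≠ 0 := by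
      intro h
      apply hl
      have h1 : (l * (2 * ω + 1)) ^ 2 = 0 := by
        linear_combination 4 * l ^ 2 * hω + 4 * hdet + h * (2 * a + l)
      simpa [hω'] using h1
    have h1 : ({s : F | 0 * s ^ 2 - (a - (-l - a)) * s - γ = 0} : Finset F) =
        {-γ / (a - (-l - a))} := by
      ext s
      simp only [mem_filter, mem_univ, true_and, mem_singleton, eq_div_iff hα]
      constructor <;> intro h <;> linear_combination -h
    rw [h1]
    zify [hq1]
    simp
    ring
  · have hne : (a - l * ω) / δ ≠ (a - l * (-1 - ω)) / δ := by
      intro h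
      field_simp at h
      apply mul_ne_zero hl hω'
      linear_combination -h
    have h1 : ({s : F | δ * s ^ 2 - (a - (-l - a)) * s - γ = 0} : Finset F) =
        {(a - l * ω) / δ, (a - l * (-1 - ω)) / δ} := by
      ext s
      simp only [mem_filter, mem_univ, true_and, mem_insert, mem_singleton, eq_div_iff hδ]
      rw [← sub_eq_zero (b := a - l * ω), ← sub_eq_zero (b := a - l * (-1 - ω)), ← mul_eq_zero]
      have key : (s * δ - (a - l * ω)) * (s * δ - (a - l * (-1 - ω))) =
          δ * (δ * s ^ 2 - (a - (-l - a)) * s - γ) := by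
        linear_combination -l ^ 2 * hω - hdet
      rw [key]
      simp [hδ]
    have h2 : ({d : F | δ * d = 0} : Finset F) = {0} := by
      ext d
      simp [hδ]
    rw [h1, h2, card_pair hne]
    zify [hq1]
    simp
    ring

lemma card_coneSection_of_nilpotent [Fintype F] {a d γ δ : F}
    (htr : a + d = 0) (hdet : a * d - γ * δ = 0) :
    (#(coneSection (a - d) γ δ) : ℤ) =
      if a = 0 ∧ γ = 0 ∧ δ = 0 then (Fintype.card F : ℤ) ^ 2 else Fintype.card F := by
  have hq1 : 1 ≤ Fintype.card F := Fintype.card_pos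
  obtain rfl : d = -a := by linear_combination htr
  by_cases hδ : δ = 0
  · subst hδ
    obtain rfl : a = 0 := by simpa using hdet
    by_cases hγ : γ = 0
    · subst hγ
      simp [card_coneSection_zero]
    · simp [card_coneSection, hγ]
  · rw [card_coneSection]
    have h1 : ({s : F | δ * s ^ 2 - (a - -a) * s - γ = 0} : Finset F) = {a / δ} := by
      ext s
      simp only [mem_filter, mem_univ, true_and, mem_singleton, eq_div_iff hδ]
      rw [← sub_eq_zero (b := a), ← sq_eq_zero_iff (a := s * δ - a)]
      have key : (s * δ - a) ^ 2 = δ * (δ * s ^ 2 - (a - -a) * s - γ) := by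
        linear_combination -hdet
      rw [key]
      simp [hδ]
    have h2 : ({d : F | δ * d = 0} : Finset F) = {0} := by
      ext d
      simp [hδ]
    rw [h1, h2]
    zify [hq1]
    simp [hδ]

lemma mulVec_single_zero_eq_zero {N : Matrix (Fin 3) (Fin 3) F} :
    N *ᵥ Pi.single 0 1 = 0 ↔ N 0 0 = 0 ∧ N 1 0 = 0 ∧ N 2 0 = 0 := by
  rw [mulVec_single_one, funext_iff, Fin.forall_fin_succ, Fin.forall_fin_two]
  rfl

lemma exists_eq_vecMulVec_single_zero {N : Matrix (Fin 3) (Fin 3) F} :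
    (∃ y, N = vecMulVec (Pi.single 0 1) y) ↔
      N 1 0 = 0 ∧ N 1 1 = 0 ∧ N 1 2 = 0 ∧ N 2 0 = 0 ∧ N 2 1 = 0 ∧ N 2 2 = 0 := by
  constructor
  · rintro ⟨y, rfl⟩
    simp [vecMulVec_apply]
  · rintro ⟨h1, h2, h3, h4, h5, h6⟩
    refine ⟨N 0, ?_⟩
    ext i j
    fin_cases i <;> fin_cases j <;> simp [vecMulVec_apply, h1, h2, h3, h4, h5, h6]

variable [Fintype F]

lemma card_filter_ker_single (M : Matrix (Fin 3) (Fin 3) F) :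
    #{N ∈ nilpotentPerp M | N *ᵥ Pi.single 0 1 = 0} =
      ∑ t ∈ coneSection (0 : F) 0 0, #{p : F × F | M 1 0 * p.1 + M 2 0 * p.2 =
        -((M 1 1 - M 2 2) * t.1 + M 2 1 * t.2.1 + M 1 2 * t.2.2)} := by
  rw [← card_sigma]
  refine card_nbij' (fun N => ⟨(N 1 1, N 1 2, N 2 1), (N 0 1, N 0 2)⟩)
    (fun w => !![0, w.2.1, w.2.2; 0, w.1.1, w.1.2.1; 0, w.1.2.2, -w.1.1]) ?_ ?_ ?_ ?_
  · intro N hN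
    simp only [coe_filter, Set.mem_ofPred_eq, mem_nilpotentPerp, mulVec_single_zero_eq_zero,
      trace_fin_three, quadForm, mul_apply, Fin.sum_univ_three] at hN
    obtain ⟨⟨h1, h2, -, h4⟩, h5, h6, h7⟩ := hN
    have h8 : N 2 2 = - N 1 1 := by linear_combination h1 - h5
    simp only [h5, h6, h7, h8] at h2 h4
    simp only [coneSection, coe_sigma, coe_filter, Set.mem_sigma_iff, Set.mem_ofPred_eq, mem_univ,
      true_and]
    exact ⟨⟨by linear_combination h2, by ring⟩, by linear_combination h4⟩
  · rintro ⟨⟨b, c, d⟩, ⟨a₁, a₂⟩⟩ h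
    simp [coneSection] at h
    obtain ⟨h1, h2⟩ := h
    simp [mem_nilpotentPerp, trace_fin_three, quadForm, mul_apply,
      Fin.sum_univ_three, det_fin_three]
    refine ⟨⟨by linear_combination h1, by linear_combination h2⟩, ?_⟩
    ext i
    fin_cases i <;> rfl
  · intro N hN
    simp only [coe_filter, Set.mem_ofPred_eq, mem_nilpotentPerp, mulVec_single_zero_eq_zero,
      trace_fin_three] at hN
    obtain ⟨⟨h1, -⟩, h5, h6, h7⟩ := hN
    have h8 : N 2 2 = - N 1 1 := by linear_combination h1 - h5
    ext i j
    fin_cases i <;> fin_cases j <;> simp [h5, h6, h7, h8]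
  · intro w _
    rfl

lemma card_filter_im_single (M : Matrix (Fin 3) (Fin 3) F) :
    #{N ∈ nilpotentPerp M | ∃ y, N = vecMulVec (Pi.single 0 1) y} =
      #{p : F × F | M 1 0 * p.1 + M 2 0 * p.2 = 0} := by
  refine card_nbij' (fun N => (N 0 1, N 0 2))
    (fun w => !![0, w.1, w.2; 0, 0, 0; 0, 0, 0]) ?_ ?_ ?_ ?_
  · intro N hN
    simp only [coe_filter, Set.mem_ofPred_eq, mem_nilpotentPerp, exists_eq_vecMulVec_single_zero,
      trace_fin_three, mul_apply, Fin.sum_univ_three] at hN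
    obtain ⟨⟨h1, -, -, h⟩, h2, h3, h4, h5, h6, h7⟩ := hN
    simp only [h2, h3, h4, h5, h6, h7, add_zero] at h1 h
    simp only [coe_filter, Set.mem_ofPred_eq, mem_univ, true_and]
    linear_combination h - M 0 0 * h1
  · rintro ⟨a, b⟩ h
    simp at h
    simpa [mem_nilpotentPerp, exists_eq_vecMulVec_single_zero, trace_fin_three, quadForm, mul_apply,
      Fin.sum_univ_three, det_fin_three] using h
  · intro N hN
    simp only [coe_filter, Set.mem_ofPred_eq, mem_nilpotentPerp, exists_eq_vecMulVec_single_zero,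
      trace_fin_three] at hN
    obtain ⟨⟨h1, -⟩, h2, h3, h4, h5, h6, h7⟩ := hN
    simp only [h3, h7, add_zero] at h1
    ext i j
    fin_cases i <;> fin_cases j <;> simp [h1, h2, h3, h4, h5, h6, h7]
  · intro w _
    rfl

lemma sum_card_linear_of_eq_zero (α γ δ : F) :
    ∑ t ∈ coneSection (0 : F) 0 0,
      #{p : F × F | 0 * p.1 + 0 * p.2 = -(α * t.1 + γ * t.2.1 + δ * t.2.2)} =
      Fintype.card F ^ 2 * #(coneSection α γ δ) := by
  have h : ∀ t : F × F × F,
      #{p : F × F | 0 * p.1 + 0 * p.2 = -(α * t.1 + γ * t.2.1 + δ * t.2.2)} =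
        if α * t.1 + γ * t.2.1 + δ * t.2.2 = 0 then Fintype.card F ^ 2 else 0 := by
    intro t
    split_ifs with h
    · simp [h, sq]
    · rw [card_eq_zero, filter_eq_empty_iff]
      intro p _ hp
      apply h
      linear_combination hp
  simp only [h]
  rw [← sum_filter, sum_const, smul_eq_mul, mul_comm]
  congr 2
  ext t
  simp [coneSection]

/-- The signed count, at the vector `(1, 0, 0)`, of the elements of `nilpotentPerp M` killing the
vector and of those whose image lies on its span. -/
lemma card_sub_card_single (hq : Fintype.card F % 3 = 1) {M : Matrix (Fin 3) (Fin 3) F}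
    (htr : trace M = 0) (hQ : quadForm M = 0) :
    (#{N ∈ nilpotentPerp M | N *ᵥ Pi.single 0 1 = 0} : ℤ) - Fintype.card F *
        #{N ∈ nilpotentPerp M | ∃ y, N = vecMulVec (Pi.single 0 1) y} =
      (Fintype.card F : ℤ) ^ 3 - (Fintype.card F : ℤ) ^ 2 +
      if M.det = 0 then
        -(if M *ᵥ Pi.single 0 1 = 0
          then (Fintype.card F : ℤ) ^ 3 - (Fintype.card F : ℤ) ^ 2 else 0) +
        (if ∃ y, M = vecMulVec (Pi.single 0 1) y
          then (Fintype.card F : ℤ) ^ 4 - (Fintype.card F : ℤ) ^ 3 else 0)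
      else 0 := by
  rw [card_filter_ker_single, card_filter_im_single]
  simp only [exists_eq_vecMulVec_single_zero, mulVec_single_zero_eq_zero]
  rw [trace_fin_three] at htr
  by_cases h : M 1 0 = 0 ∧ M 2 0 = 0
  · have hdet : M.det = M 0 0 * (M 1 1 * M 2 2 - M 2 1 * M 1 2) := by
      rw [det_fin_three, h.1, h.2]
      ring
    have hmin : M 1 1 * M 2 2 - M 2 1 * M 1 2 = M 0 0 ^ 2 := by
      simp only [quadForm, h.1, h.2] at hQ
      linear_combination -hQ - M 0 0 * htr
    rw [hmin] at hdet
    have hdet0 : M.det = 0 ↔ M 0 0 = 0 := by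
      rw [hdet]
      simp
    simp only [h.1, h.2, sum_card_linear_of_eq_zero]
    by_cases h0 : M 0 0 = 0
    · rw [if_pos (hdet0.mpr h0)]
      push_cast
      rw [card_coneSection_of_nilpotent (by simpa [h0] using htr) (by simpa [h0] using hmin)]
      have h22 : M 1 1 = 0 → M 2 2 = 0 := fun h11 => by simpa [h0, h11] using htr
      by_cases hz : M 1 1 = 0 ∧ M 2 1 = 0 ∧ M 1 2 = 0
      · rw [if_pos hz]
        simp [h0, hz, h22 hz.1]
        ring
      · have hz' : ¬(M 1 1 = 0 ∧ M 1 2 = 0 ∧ M 2 1 = 0 ∧ M 2 2 = 0) := by tauto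
        rw [if_neg hz]
        simp [h0, hz']
        ring
    · rw [if_neg (mt hdet0.mp h0)]
      push_cast
      rw [card_coneSection_of_ne_zero hq h0 htr hmin]
      simp
      ring
  · simp only [card_linear_eq h, sum_const, card_coneSection_zero]
    have hk : ¬(M 0 0 = 0 ∧ M 1 0 = 0 ∧ M 2 0 = 0) := by tauto
    have hi : ¬(M 1 0 = 0 ∧ M 1 1 = 0 ∧ M 1 2 = 0 ∧ M 2 0 = 0 ∧ M 2 1 = 0 ∧ M 2 2 = 0) := by
      tauto
    rw [if_neg hk, if_neg hi]
    simp
    ring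

lemma card_sub_card (hq : Fintype.card F % 3 = 1) {M : Matrix (Fin 3) (Fin 3) F}
    (htr : trace M = 0) (hQ : quadForm M = 0) {x : Fin 3 → F} (hx : x ≠ 0) :
    (#{N ∈ nilpotentPerp M | N *ᵥ x = 0} : ℤ) - Fintype.card F *
        #{N ∈ nilpotentPerp M | ∃ y, N = vecMulVec x y} =
      (Fintype.card F : ℤ) ^ 3 - (Fintype.card F : ℤ) ^ 2 +
      if M.det = 0 then
        -(if M *ᵥ x = 0 then (Fintype.card F : ℤ) ^ 3 - (Fintype.card F : ℤ) ^ 2 else 0) +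
        (if ∃ y, M = vecMulVec x y
          then (Fintype.card F : ℤ) ^ 4 - (Fintype.card F : ℤ) ^ 3 else 0)
      else 0 := by
  obtain ⟨g, rfl⟩ := exists_unit_mulVec_single hx
  have hker : (g⁻¹.1 * M * g.1) *ᵥ Pi.single 0 1 = 0 ↔ M *ᵥ (g.1 *ᵥ Pi.single 0 1) = 0 := by
    rw [← mulVec_mulVec, ← mulVec_mulVec]
    exact ⟨fun h => by simpa using congrArg (g.1 *ᵥ ·) h, fun h => by rw [h, mulVec_zero]⟩
  rw [card_filter_ker_conj, card_filter_im_conj,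
    card_sub_card_single hq (by rwa [trace_units_conj']) (by rwa [quadForm_units_conj])]
  simp only [det_units_conj', hker, exists_conj_eq_vecMulVec]

lemma sum_ite_ker {M : Matrix (Fin 3) (Fin 3) F} (r : ℤ) :
    ∑ x : Fin 3 → F with x ≠ 0, (if M *ᵥ x = 0 then r else 0) = #(kerVectors M) * r := by
  rw [← sum_filter, sum_const, nsmul_eq_mul, filter_filter, kerVectors]

lemma sum_ite_im {M : Matrix (Fin 3) (Fin 3) F} (r : ℤ) :
    ∑ x : Fin 3 → F with x ≠ 0, (if ∃ y, M = vecMulVec x y then r else 0) =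
      #(imVectors M) * r := by
  rw [← sum_filter, sum_const, nsmul_eq_mul, filter_filter, imVectors]

lemma card_filter_ne_zero :
    (#{x : Fin 3 → F | x ≠ 0} : ℤ) = (Fintype.card F : ℤ) ^ 3 - 1 := by
  rw [filter_ne', card_erase_of_mem (mem_univ _), card_univ, Nat.cast_sub Fintype.card_pos]
  simp

lemma sum_card_filter_ker (M : Matrix (Fin 3) (Fin 3) F) :
    ∑ x : Fin 3 → F with x ≠ 0, (#{N ∈ nilpotentPerp M | N *ᵥ x = 0} : ℤ) =
      ∑ N ∈ nilpotentPerp M, (#(kerVectors N) : ℤ) := by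
  have := sum_card_bipartiteAbove_eq_sum_card_bipartiteBelow (s := {x : Fin 3 → F | x ≠ 0})
    (t := nilpotentPerp M) (fun x N => N *ᵥ x = 0)
  simp only [bipartiteAbove, bipartiteBelow, filter_filter] at this
  exact_mod_cast this

lemma sum_card_filter_im (M : Matrix (Fin 3) (Fin 3) F) :
    ∑ x : Fin 3 → F with x ≠ 0, (#{N ∈ nilpotentPerp M | ∃ y, N = vecMulVec x y} : ℤ) =
      ∑ N ∈ nilpotentPerp M, (#(imVectors N) : ℤ) := by
  have := sum_card_bipartiteAbove_eq_sum_card_bipartiteBelow (s := {x : Fin 3 → F | x ≠ 0})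
    (t := nilpotentPerp M) (fun x N => ∃ y, N = vecMulVec x y)
  simp only [bipartiteAbove, bipartiteBelow, filter_filter] at this
  exact_mod_cast this

lemma sum_kerVectors_sub_imVectors (M : Matrix (Fin 3) (Fin 3) F) :
    ∑ N ∈ nilpotentPerp M, ((#(kerVectors N) : ℤ) - Fintype.card F * #(imVectors N)) =
      (Fintype.card F - 1) * #((nilpotentPerp M).erase 0) +
        ((Fintype.card F : ℤ) ^ 3 - 1) * (1 - Fintype.card F) := by
  have h0 : (0 : Matrix (Fin 3) (Fin 3) F) ∈ nilpotentPerp M := by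
    simp [mem_nilpotentPerp, quadForm, det_zero]
  have hk : kerVectors (0 : Matrix (Fin 3) (Fin 3) F) = ({x | x ≠ 0} : Finset _) := by
    ext x
    simp [kerVectors]
  have hi : imVectors (0 : Matrix (Fin 3) (Fin 3) F) = ({x | x ≠ 0} : Finset _) := by
    ext x
    simp only [imVectors, mem_filter, mem_univ, true_and, and_iff_left_iff_imp]
    exact fun _ => ⟨0, by simp⟩
  rw [← add_sum_erase _ _ h0, hk, hi, card_filter_ne_zero,
    sum_congr rfl (g := fun _ => (Fintype.card F : ℤ) - 1), sum_const, nsmul_eq_mul]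
  · ring
  · intro N hN
    rw [mem_erase, mem_nilpotentPerp] at hN
    rw [card_kerVectors hN.1 hN.2.2.2.1]
    ring

lemma card_nilpotentPerp (hq : Fintype.card F % 3 = 1) {M : Matrix (Fin 3) (Fin 3) F}
    (hM : M ≠ 0) (htr : trace M = 0) (hQ : quadForm M = 0) :
    (#((nilpotentPerp M).erase 0) : ℤ) =
      ((Fintype.card F : ℤ) ^ 3 - 1) * ((Fintype.card F : ℤ) ^ 2 + 1) -
        if M.det = 0 then (Fintype.card F : ℤ) ^ 2 * (Fintype.card F - 1) else 0 := by
  have hq1 : (1 : ℤ) < Fintype.card F := by exact_mod_cast Fintype.one_lt_card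
  have h := sum_kerVectors_sub_imVectors M
  rw [sum_sub_distrib, ← mul_sum, ← sum_card_filter_ker, ← sum_card_filter_im, mul_sum,
    ← sum_sub_distrib,
    sum_congr rfl fun x hx => card_sub_card hq htr hQ (mem_filter.mp hx).2] at h
  rw [sum_add_distrib, sum_const, nsmul_eq_mul, card_filter_ne_zero] at h
  apply mul_left_cancel₀ (sub_ne_zero.mpr hq1.ne')
  split_ifs at h ⊢ with hdet
  · rw [sum_add_distrib, sum_neg_distrib, sum_ite_ker, sum_ite_im, card_kerVectors hM hdet] at h
    linear_combination -h
  · rw [sum_const_zero] at h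
    linear_combination -h

lemma setOf_ovoid_eq (M : Matrix (Fin 3) (Fin 3) F) :
    {N : Matrix (Fin 3) (Fin 3) F | N ≠ 0 ∧ Matrix.trace N = 0 ∧ quadForm N = 0 ∧
      N.det = 0 ∧ Matrix.trace (M * N) = 0} = ((nilpotentPerp M).erase 0 : Finset _) := by
  ext N
  simp [mem_nilpotentPerp, and_comm]

end

end

theorem ovoid_perp_counts
    (F : Type*) [Field F] [Fintype F] (q : ℕ)
    (hcard : Fintype.card F = q) (hq : q % 3 = 1)
    (M : Matrix (Fin 3) (Fin 3) F) (hM0 : M ≠ 0)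
    (htr : Matrix.trace M = 0) (hQ : quadForm M = 0) :
    (M.det = 0 →
      {N : Matrix (Fin 3) (Fin 3) F | N ≠ 0 ∧ Matrix.trace N = 0 ∧ quadForm N = 0 ∧
          N.det = 0 ∧ Matrix.trace (M * N) = 0}.ncard
        = (q - 1) * (q ^ 4 + q ^ 3 + q ^ 2 + q + 1)) ∧
    (M.det ≠ 0 →
      {N : Matrix (Fin 3) (Fin 3) F | N ≠ 0 ∧ Matrix.trace N = 0 ∧ quadForm N = 0 ∧
          N.det = 0 ∧ Matrix.trace (M * N) = 0}.ncard
        = (q - 1) * ((q ^ 2 + 1) * (q ^ 2 + q + 1))) := by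
  subst hcard
  have hq1 : 1 ≤ Fintype.card F := Fintype.card_pos
  have h := card_nilpotentPerp hq hM0 htr hQ
  rw [setOf_ovoid_eq, Set.ncard_coe_finset]
  constructor
  · intro hdet
    zify [hq1]
    rw [h, if_pos hdet]
    ring
  · intro hdet
    zify [hq1]
    rw [h, if_neg hdet]
    ring
end

section
/- Let F be a finite field with q elements, q ≡ 1 (mod 3). There exists a 2-dimensional F-linear subspace L of the space of 3×3 matrices over F such that every M ∈ L satisfies Tr(M) = 0 and Q(M) = 0, and the number of nonzero M ∈ L with det(M) = 0 equals 3(q−1). (That is, there is a line of the hyperbolic quadric Q⁺(7,q) meeting the set O in exactly three points.) -/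
/-- A finite field whose order is `1` modulo `3` contains a primitive cube root of unity. -/
theorem exists_isPrimitiveRoot_three_of_card_mod_three
    (F : Type*) [Field F] [Fintype F] (h : Fintype.card F % 3 = 1) :
    ∃ w : F, IsPrimitiveRoot w 3 := by
  classical
  have hdvd : 3 ∣ Fintype.card Fˣ := by
    rw [Fintype.card_units]
    lia
  have : Fact (Nat.Prime 3) := ⟨Nat.prime_three⟩
  obtain ⟨u, hu⟩ := exists_prime_orderOf_dvd_card 3 hdvd
  exact ⟨u, IsPrimitiveRoot.coe_units_iff.mpr (hu ▸ IsPrimitiveRoot.orderOf u)⟩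

/-- The pencil spanned by `diag(1, w, w²)` and the cyclic permutation matrix. -/
def clockShift {F : Type*} [Field F] (w : F) : F × F →ₗ[F] Matrix (Fin 3) (Fin 3) F where
  toFun p := !![p.1, p.2, 0; 0, w * p.1, p.2; p.2, 0, w ^ 2 * p.1]
  map_add' p r := by
    ext i j
    fin_cases i <;> fin_cases j <;> simp [mul_add]
  map_smul' c p := by
    ext i j
    fin_cases i <;> fin_cases j <;> simp [mul_left_comm]

theorem clockShift_apply {F : Type*} [Field F] (w x y : F) :
    clockShift w (x, y) = !![x, y, 0; 0, w * x, y; y, 0, w ^ 2 * x] := rfl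

theorem clockShift_injective {F : Type*} [Field F] (w : F) :
    Function.Injective (clockShift w) := by
  rintro ⟨x, y⟩ ⟨x', y'⟩ h
  have h0 := congrFun (congrFun h 0) 0
  have h1 := congrFun (congrFun h 0) 1
  simp only [clockShift_apply] at h0 h1
  exact Prod.ext (by simpa using h0) (by simpa using h1)

theorem det_clockShift {F : Type*} [Field F] {w : F} (hw : w ^ 3 = 1) (x y : F) :
    (clockShift w (x, y)).det = x ^ 3 + y ^ 3 := by
  rw [clockShift_apply, Matrix.det_fin_three]
  simp
  linear_combination x ^ 3 * hw

theorem trace_clockShift {F : Type*} [Field F] {w : F} (hw : 1 + w + w ^ 2 = 0) (x y : F) :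
    (clockShift w (x, y)).trace = 0 := by
  rw [clockShift_apply, Matrix.trace_fin_three]
  simp
  linear_combination x * hw

theorem quadForm_clockShift {F : Type*} [Field F] {w : F} (hw : 1 + w + w ^ 2 = 0) (x y : F) :
    quadForm (clockShift w (x, y)) = 0 := by
  rw [clockShift_apply, quadForm]
  simp
  linear_combination (-w * x ^ 2) * hw

/-- The nonzero singular matrices of the pencil are parametrized by a cube root of unity
and a nonzero scalar. -/
theorem ncard_singular_clockShift {F : Type*} [Field F] [Fintype F] {w : F}
    (hw : IsPrimitiveRoot w 3) :
    {M | M ∈ LinearMap.range (clockShift w) ∧ M ≠ 0 ∧ M.det = 0}.ncard =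
      3 * (Fintype.card F - 1) := by
  classical
  let f : Fin 3 × Fˣ → Matrix (Fin 3) (Fin 3) F :=
    fun p => clockShift w (-(w ^ (p.1 : ℕ) * p.2), p.2)
  have hf : Function.Injective f := by
    rintro ⟨i, u⟩ ⟨j, v⟩ h
    have h' := clockShift_injective w h
    simp only [Prod.mk.injEq, neg_inj] at h'
    obtain ⟨h1, h2⟩ := h'
    obtain rfl := Units.ext h2
    have h3 := hw.pow_inj i.2 j.2 (mul_right_cancel₀ u.ne_zero h1)
    rw [Fin.ext h3]
  have hset : {M | M ∈ LinearMap.range (clockShift w) ∧ M ≠ 0 ∧ M.det = 0} = Set.range f := by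
    ext M
    constructor
    · rintro ⟨⟨⟨x, y⟩, rfl⟩, hne, hdet⟩
      rw [det_clockShift hw.pow_eq_one] at hdet
      have hy : y ≠ 0 := by
        rintro rfl
        have hx : x = 0 := by simpa using hdet
        subst hx
        exact hne (map_zero (clockShift w))
      have hroot : (-(x / y)) ^ 3 = 1 := by
        field_simp
        linear_combination -hdet
      obtain ⟨i, hi, hiw⟩ := hw.eq_pow_of_pow_eq_one hroot
      refine ⟨(⟨i, hi⟩, Units.mk0 y hy), ?_⟩
      simp only [f, hiw, Units.val_mk0]
      congr 2
      field_simp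
    · rintro ⟨⟨i, u⟩, rfl⟩
      refine ⟨⟨_, rfl⟩, fun h => ?_, ?_⟩
      · have h' := clockShift_injective w (h.trans (map_zero (clockShift w)).symm)
        exact u.ne_zero (congrArg Prod.snd h')
      · have hi : (w ^ (i : ℕ)) ^ 3 = 1 := by
          rw [pow_right_comm, hw.pow_eq_one, one_pow]
        rw [det_clockShift hw.pow_eq_one]
        linear_combination (-(u : F) ^ 3) * hi
  rw [hset, ← Set.image_univ, Set.ncard_image_of_injective _ hf, Set.ncard_univ,
    Nat.card_eq_fintype_card, Fintype.card_prod, Fintype.card_fin, Fintype.card_units]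

theorem line_meeting_ovoid_in_three_points
    (F : Type*) [Field F] [Fintype F] (q : ℕ)
    (hcard : Fintype.card F = q) (hq : q % 3 = 1) :
    ∃ L : Submodule F (Matrix (Fin 3) (Fin 3) F),
      Module.finrank F L = 2 ∧
      (∀ M ∈ L, Matrix.trace M = 0 ∧ quadForm M = 0) ∧
      {M : Matrix (Fin 3) (Fin 3) F | M ∈ L ∧ M ≠ 0 ∧ M.det = 0}.ncard = 3 * (q - 1) := by
  subst hcard
  obtain ⟨w, hw⟩ := exists_isPrimitiveRoot_three_of_card_mod_three F hq
  have hsum : 1 + w + w ^ 2 = 0 := by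
    simpa [Finset.sum_range_succ] using hw.geom_sum_eq_zero (by norm_num)
  refine ⟨LinearMap.range (clockShift w), ?_, ?_, ncard_singular_clockShift hw⟩
  · rw [LinearMap.finrank_range_of_inj (clockShift_injective w)]
    simp
  · rintro _ ⟨⟨x, y⟩, rfl⟩
    exact ⟨trace_clockShift hsum x y, quadForm_clockShift hsum x y⟩
end

section
/- Let F be a finite field with q elements, q ≡ 1 (mod 3). The F-linear span of the set of nonzero 3×3 matrices M over F with Tr(M) = 0, Q(M) = 0 and det(M) = 0 equals the full 8-dimensional subspace of trace-zero 3×3 matrices over F. (That is, the (q²+q+1)-ovoid O is not contained in any hyperplane of PG(7,q).) -/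
/-- A trace-zero 3×3 matrix is an explicit linear combination of eight nilpotent matrices. -/
theorem trace_zero_eq_combination_of_nilpotents {F : Type*} [Field F]
    (M : Matrix (Fin 3) (Fin 3) F) (hM : M.trace = 0) :
    M = M 0 0 • !![1, 0, -1; 0, 0, 0; 1, 0, -1] + M 1 1 • !![0, 0, 0; 0, 1, -1; 0, 1, -1]
      + M 0 1 • !![0, 1, 0; 0, 0, 0; 0, 0, 0] + (M 0 2 + M 0 0) • !![0, 0, 1; 0, 0, 0; 0, 0, 0]
      + M 1 0 • !![0, 0, 0; 1, 0, 0; 0, 0, 0] + (M 1 2 + M 1 1) • !![0, 0, 0; 0, 0, 1; 0, 0, 0]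
      + (M 2 0 - M 0 0) • !![0, 0, 0; 0, 0, 0; 1, 0, 0]
      + (M 2 1 - M 1 1) • !![0, 0, 0; 0, 0, 0; 0, 1, 0] := by
  rw [Matrix.trace_fin_three] at hM
  ext i j
  fin_cases i <;> fin_cases j <;> simp
  linear_combination hM


theorem ovoid_spans_trace_zero_matrices
    (F : Type*) [Field F] [Fintype F] (q : ℕ)
    (hcard : Fintype.card F = q) (hq : q % 3 = 1) :
    (Submodule.span F
        {M : Matrix (Fin 3) (Fin 3) F | M ≠ 0 ∧ Matrix.trace M = 0 ∧
          quadForm M = 0 ∧ M.det = 0} : Set (Matrix (Fin 3) (Fin 3) F))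
      = {M : Matrix (Fin 3) (Fin 3) F | Matrix.trace M = 0} := by
  ext M
  constructor
  · intro hM
    have hle : Submodule.span F {M : Matrix (Fin 3) (Fin 3) F | M ≠ 0 ∧ Matrix.trace M = 0 ∧
        quadForm M = 0 ∧ M.det = 0} ≤ LinearMap.ker (Matrix.traceLinearMap (Fin 3) F F) :=
      Submodule.span_le.2 fun N hN => hN.2.1
    exact hle hM
  · intro hM
    rw [trace_zero_eq_combination_of_nilpotents M hM]
    refine add_mem (add_mem (add_mem (add_mem (add_mem (add_mem (add_mem
      ?_ ?_) ?_) ?_) ?_) ?_) ?_) ?_ <;>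
    · refine Submodule.smul_mem _ _ (Submodule.subset_span ⟨fun h => ?_, ?_, ?_, ?_⟩)
      · simp [← Matrix.ext_iff, Fin.forall_fin_succ] at h
      · simp [Matrix.trace_fin_three]
      · simp [quadForm]
      · simp [Matrix.det_fin_three]
end

section
/- Let F be a finite field with q elements, q ≡ 1 (mod 3). The number of nonzero 3×3 matrices M over F with M² = 0 and M₃₁ = 0 equals (q−1)(2q²+2q+1). (This expresses that the hyperplane P₁^⊥, where P₁ = E₁₃ is a point of the hexagon Γ, contains exactly 2q²+2q+1 points of Γ.) -/
/-- The square-zero matrices whose only nonzero row is the first one, together with zero. -/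
def firstRowNilpotent {F : Type*} [Field F] (p : F × F) : Matrix (Fin 3) (Fin 3) F :=
  !![0, p.1, p.2; 0, 0, 0; 0, 0, 0]

/-- The square-zero matrices with column space spanned by `(a, 1, 0)`, together with zero. -/
def secondRowNilpotent {F : Type*} [Field F] (p : F × F × F) : Matrix (Fin 3) (Fin 3) F :=
  !![p.1 * p.2.1, -(p.1 ^ 2 * p.2.1), p.1 * p.2.2; p.2.1, -(p.1 * p.2.1), p.2.2; 0, 0, 0]

/-- The square-zero matrices with column space spanned by `(a, b, 1)` and vanishing first column,
together with zero. -/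
def thirdRowNilpotent {F : Type*} [Field F] (p : F × F × F) : Matrix (Fin 3) (Fin 3) F :=
  !![0, p.1 * p.2.2, -(p.1 * p.2.1 * p.2.2); 0, p.2.1 * p.2.2, -(p.2.1 ^ 2 * p.2.2);
    0, p.2.2, -(p.2.1 * p.2.2)]

theorem firstRowNilpotent_injective {F : Type*} [Field F] :
    Function.Injective (firstRowNilpotent (F := F)) := by
  rintro ⟨x, y⟩ ⟨x', y'⟩ h
  have h₁ := congrFun (congrFun h 0) 1
  have h₂ := congrFun (congrFun h 0) 2
  simp_all [firstRowNilpotent]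

theorem secondRowNilpotent_injOn {F : Type*} [Field F] :
    Set.InjOn (secondRowNilpotent (F := F)) (Set.univ ×ˢ {0}ᶜ) := by
  rintro ⟨a, x, y⟩ hp ⟨a', x', y'⟩ - h
  have h₁ := congrFun (congrFun h 0) 0
  have h₂ := congrFun (congrFun h 0) 2
  have h₃ := congrFun (congrFun h 1) 0
  have h₄ := congrFun (congrFun h 1) 2
  simp [secondRowNilpotent] at h₁ h₂ h₃ h₄ hp
  by_cases hx : x = 0 <;> grind

theorem thirdRowNilpotent_injOn {F : Type*} [Field F] :
    Set.InjOn (thirdRowNilpotent (F := F)) (Set.univ ×ˢ Set.univ ×ˢ {0}ᶜ) := by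
  rintro ⟨a, b, y⟩ hp ⟨a', b', y'⟩ - h
  have h₁ := congrFun (congrFun h 0) 1
  have h₂ := congrFun (congrFun h 1) 1
  have h₃ := congrFun (congrFun h 2) 1
  simp [thirdRowNilpotent] at h₁ h₂ h₃ hp
  grind

theorem setOf_sq_zero_eq_union {F : Type*} [Field F] :
    {M : Matrix (Fin 3) (Fin 3) F | M ≠ 0 ∧ M * M = 0 ∧ M 2 0 = 0} =
      firstRowNilpotent '' {0}ᶜ ∪ secondRowNilpotent '' (Set.univ ×ˢ {0}ᶜ) ∪
        thirdRowNilpotent '' (Set.univ ×ˢ Set.univ ×ˢ {0}ᶜ) := by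
  ext M
  constructor
  · rintro ⟨hM, hsq, h₂₀⟩
    have e (i j : Fin 3) : M i 0 * M 0 j + M i 1 * M 1 j + M i 2 * M 2 j = 0 := by
      simpa [Matrix.mul_apply, Fin.sum_univ_three] using congrFun (congrFun hsq i) j
    have e₀₀ := e 0 0
    have e₀₁ := e 0 1
    have e₀₂ := e 0 2
    have e₁₀ := e 1 0
    have e₁₁ := e 1 1
    have e₁₂ := e 1 2
    have e₂₀ := e 2 0
    have e₂₁ := e 2 1
    have e₂₂ := e 2 2
    by_cases h₂₁ : M 2 1 = 0
    · have h₂₂ : M 2 2 = 0 := by grind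
      left
      by_cases h₁₀ : M 1 0 = 0
      · have h₁₁ : M 1 1 = 0 := by grind
        have h₀₀ : M 0 0 = 0 := by grind
        by_cases h₁₂ : M 1 2 = 0
        · have key : firstRowNilpotent (M 0 1, M 0 2) = M := by
            ext i j
            fin_cases i <;> fin_cases j <;> simp [firstRowNilpotent, *]
          refine Or.inl ⟨(M 0 1, M 0 2), fun h => hM ?_, key⟩
          rw [← key, show (M 0 1, M 0 2) = 0 from h]
          ext i j
          fin_cases i <;> fin_cases j <;> rfl
        · refine Or.inr ⟨(M 0 2 / M 1 2, 0, M 1 2), by simp [h₁₂], ?_⟩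
          have h₀₁ : M 0 1 = 0 := by grind
          ext i j
          fin_cases i <;> fin_cases j <;> simp [secondRowNilpotent, *]
      · refine Or.inr ⟨(-M 1 1 / M 1 0, M 1 0, M 1 2), by simp [h₁₀], ?_⟩
        ext i j
        fin_cases i <;> fin_cases j <;> simp [secondRowNilpotent] <;> grind
    · refine Or.inr ⟨(M 0 1 / M 2 1, -M 2 2 / M 2 1, M 2 1), by simp [h₂₁], ?_⟩
      have h₁₀ : M 1 0 = 0 := by grind
      have h₀₀ : M 0 0 = 0 := by grind
      ext i j
      fin_cases i <;> fin_cases j <;> simp [thirdRowNilpotent] <;> grind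
  · rintro ((⟨⟨x, y⟩, hp, rfl⟩ | ⟨⟨a, x, y⟩, hp, rfl⟩) | ⟨⟨a, b, y⟩, hp, rfl⟩)
    · refine ⟨fun h => hp ?_, ?_, rfl⟩
      · exact Prod.ext (congrFun (congrFun h 0) 1) (congrFun (congrFun h 0) 2)
      · ext i j
        fin_cases i <;> fin_cases j <;>
          simp [firstRowNilpotent, Matrix.mul_apply, Fin.sum_univ_three]
    · refine ⟨fun h => hp.2 ?_, ?_, rfl⟩
      · exact Prod.ext (congrFun (congrFun h 1) 0) (congrFun (congrFun h 1) 2)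
      · ext i j
        fin_cases i <;> fin_cases j <;>
          simp [secondRowNilpotent, Matrix.mul_apply, Fin.sum_univ_three] <;> ring
    · refine ⟨fun h => hp.2.2 (congrFun (congrFun h 2) 1), ?_, rfl⟩
      ext i j
      fin_cases i <;> fin_cases j <;>
        simp [thirdRowNilpotent, Matrix.mul_apply, Fin.sum_univ_three] <;> ring

theorem disjoint_firstRowNilpotent_secondRowNilpotent {F : Type*} [Field F] :
    Disjoint (firstRowNilpotent (F := F) '' {0}ᶜ)
      (secondRowNilpotent '' (Set.univ ×ˢ {0}ᶜ)) := by
  rw [Set.disjoint_left]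
  rintro _ ⟨_, -, rfl⟩ ⟨p, hp, h⟩
  exact hp.2 (Prod.ext (congrFun (congrFun h 1) 0) (congrFun (congrFun h 1) 2))

theorem disjoint_union_thirdRowNilpotent {F : Type*} [Field F] :
    Disjoint (firstRowNilpotent (F := F) '' {0}ᶜ ∪ secondRowNilpotent '' (Set.univ ×ˢ {0}ᶜ))
      (thirdRowNilpotent '' (Set.univ ×ˢ Set.univ ×ˢ {0}ᶜ)) := by
  rw [Set.disjoint_left]
  rintro _ (⟨_, -, rfl⟩ | ⟨_, -, rfl⟩) ⟨p, hp, h⟩ <;>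
    exact hp.2.2 (congrFun (congrFun h 2) 1)

theorem hexagon_points_in_P1_perp
    (F : Type*) [Field F] [Fintype F] (q : ℕ)
    (hcard : Fintype.card F = q) (hq : q % 3 = 1) :
    {M : Matrix (Fin 3) (Fin 3) F | M ≠ 0 ∧ M * M = 0 ∧ M 2 0 = 0}.ncard
      = (q - 1) * (2 * q ^ 2 + 2 * q + 1) := by
  rw [setOf_sq_zero_eq_union,
    Set.ncard_union_eq disjoint_union_thirdRowNilpotent (Set.toFinite _) (Set.toFinite _),
    Set.ncard_union_eq disjoint_firstRowNilpotent_secondRowNilpotent (Set.toFinite _)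
      (Set.toFinite _),
    Set.ncard_image_of_injective _ firstRowNilpotent_injective,
    secondRowNilpotent_injOn.ncard_image, thirdRowNilpotent_injOn.ncard_image]
  have hF : ({0}ᶜ : Set F).ncard = q - 1 := by
    rw [Set.ncard_compl _ (Set.toFinite _), Set.ncard_singleton, Nat.card_eq_fintype_card, hcard]
  have hFF : ({0}ᶜ : Set (F × F)).ncard = q * q - 1 := by
    rw [Set.ncard_compl _ (Set.toFinite _), Set.ncard_singleton, Nat.card_prod,
      Nat.card_eq_fintype_card, hcard]
  simp only [Set.ncard_prod, Set.ncard_univ, hF, hFF, Nat.card_eq_fintype_card, hcard]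
  obtain ⟨n, rfl⟩ : ∃ n, q = n + 1 := ⟨q - 1, by omega⟩
  rw [show (n + 1) * (n + 1) - 1 = n * (n + 2) by rw [Nat.sub_eq_iff_eq_add (by nlinarith)]; ring]
  simp only [Nat.add_sub_cancel]
  ring
end

section
/- Let F be a finite field with q elements, q ≡ 1 (mod 3), and let ζ ∈ F be a primitive cube root of unity (ζ³ = 1, ζ ≠ 1). The number of nonzero 3×3 matrices M over F with M² = 0 and M₁₁ + ζ·M₂₂ + ζ²·M₃₃ = 0 equals (q−1)(q²+4q+1). (This expresses that the hyperplane P₃^⊥, where P₃ = diag(1, ζ, ζ²), contains exactly q²+4q+1 points of the hexagon Γ.) -/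
open Matrix in
theorem adjugate_fin_three_eq_sq_sub_trace_smul_add {R : Type*} [CommRing R]
    (M : Matrix (Fin 3) (Fin 3) R) :
    M.adjugate = M * M - M.trace • M + M.adjugate.trace • (1 : Matrix (Fin 3) (Fin 3) R) := by
  ext i j
  rw [adjugate_fin_three]
  fin_cases i <;> fin_cases j <;>
    simp [trace_fin_three, mul_apply, Fin.sum_univ_three] <;> ring

theorem trace_eq_zero_of_mul_self_eq_zero {F : Type*} [Field F]
    {M : Matrix (Fin 3) (Fin 3) F} (h : M * M = 0) : M.trace = 0 :=
  (Matrix.isNilpotent_trace_of_isNilpotent ⟨2, by rw [pow_two, h]⟩).eq_zero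

theorem adjugate_eq_zero_of_mul_self_eq_zero {F : Type*} [Field F]
    {M : Matrix (Fin 3) (Fin 3) F} (h : M * M = 0) (h0 : M ≠ 0) : M.adjugate = 0 := by
  have hd : M.det = 0 := by simpa using congrArg Matrix.det h
  have hadj := adjugate_fin_three_eq_sq_sub_trace_smul_add M
  rw [h, trace_eq_zero_of_mul_self_eq_zero h, zero_smul, sub_zero, zero_add] at hadj
  have hs : M.adjugate.trace • M = 0 := by
    have hm := Matrix.mul_adjugate M
    rwa [hadj, hd, zero_smul, Matrix.mul_smul, mul_one] at hm
  rw [hadj, (smul_eq_zero.mp hs).resolve_right h0, zero_smul]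

/-- The matrices of rank one with diagonal `t, ζ t, ζ² t` for `t ≠ 0`, together with the six
families of nonzero square-zero matrices with zero diagonal. -/
def hexagonParam {F : Type*} [Field F] (ζ : F) :
    (Fˣ × Fˣ × Fˣ) ⊕ (Fin 6 × Fˣ × F) → Matrix (Fin 3) (Fin 3) F
  | .inl (t, x, y) => !![(t : F), t * ζ * (x : F)⁻¹, t * ζ ^ 2 * (y : F)⁻¹;
      t * x, t * ζ, t * ζ ^ 2 * x * (y : F)⁻¹;
      t * y, t * ζ * y * (x : F)⁻¹, t * ζ ^ 2]
  | .inr (0, u, a) => !![0, (u : F), a; 0, 0, 0; 0, 0, 0]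
  | .inr (1, u, a) => !![0, 0, 0; a, 0, (u : F); 0, 0, 0]
  | .inr (2, u, a) => !![0, 0, 0; 0, 0, 0; (u : F), a, 0]
  | .inr (3, u, a) => !![0, 0, 0; (u : F), 0, 0; a, 0, 0]
  | .inr (4, u, a) => !![0, a, 0; 0, 0, 0; 0, (u : F), 0]
  | .inr (5, u, a) => !![0, 0, (u : F); 0, 0, a; 0, 0, 0]

theorem hexagonParam_injective {F : Type*} [Field F] (ζ : F) :
    Function.Injective (hexagonParam ζ) := by
  rintro (⟨t, x, y⟩ | ⟨i, u, a⟩) (⟨t', x', y'⟩ | ⟨i', u', a'⟩) h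
  · have h00 := congrFun (congrFun h 0) 0
    have h10 := congrFun (congrFun h 1) 0
    have h20 := congrFun (congrFun h 2) 0
    simp [hexagonParam] at h00 h10 h20
    obtain rfl : t = t' := Units.ext h00
    simp_all [Units.ext_iff]
  · have h00 := congrFun (congrFun h 0) 0
    fin_cases i' <;> simp [hexagonParam] at h00
  · have h00 := congrFun (congrFun h 0) 0
    fin_cases i <;> simp [hexagonParam, eq_comm] at h00
  · have h01 := congrFun (congrFun h 0) 1
    have h02 := congrFun (congrFun h 0) 2
    have h10 := congrFun (congrFun h 1) 0
    have h12 := congrFun (congrFun h 1) 2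
    have h20 := congrFun (congrFun h 2) 0
    have h21 := congrFun (congrFun h 2) 1
    have hu := u.ne_zero
    have hu' := u'.ne_zero
    fin_cases i <;> fin_cases i' <;> simp [hexagonParam] at h01 h02 h10 h12 h20 h21 <;>
      simp_all [Units.ext_iff]

theorem hexagonParam_mem {F : Type*} [Field F] {ζ : F} (hζ : 1 + ζ + ζ ^ 2 = 0)
    (p : (Fˣ × Fˣ × Fˣ) ⊕ (Fin 6 × Fˣ × F)) :
    hexagonParam ζ p ≠ 0 ∧ hexagonParam ζ p * hexagonParam ζ p = 0 ∧
      hexagonParam ζ p 0 0 + ζ * hexagonParam ζ p 1 1 + ζ ^ 2 * hexagonParam ζ p 2 2 = 0 := by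
  obtain ⟨t, x, y⟩ | ⟨i, u, a⟩ := p
  · have hx := x.ne_zero
    have hy := y.ne_zero
    refine ⟨fun h => t.ne_zero (congrFun (congrFun h 0) 0), ?_, ?_⟩
    · ext i j
      fin_cases i <;> fin_cases j <;>
        simp [hexagonParam, Matrix.mul_apply, Fin.sum_univ_three] <;> field_simp <;>
        grind
    · simp [hexagonParam]
      grind
  · have hu := u.ne_zero
    refine ⟨fun h => ?_, ?_, ?_⟩
    · have h01 := congrFun (congrFun h 0) 1
      have h02 := congrFun (congrFun h 0) 2
      have h10 := congrFun (congrFun h 1) 0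
      have h12 := congrFun (congrFun h 1) 2
      have h20 := congrFun (congrFun h 2) 0
      have h21 := congrFun (congrFun h 2) 1
      fin_cases i <;> simp_all [hexagonParam]
    · fin_cases i <;> ext i j <;> fin_cases i <;> fin_cases j <;>
        simp [hexagonParam, Matrix.mul_apply, Fin.sum_univ_three]
    · fin_cases i <;> simp [hexagonParam]

theorem exists_hexagonParam_eq {F : Type*} [Field F] {ζ : F} (hζ : 1 + ζ + ζ ^ 2 = 0)
    (hζ1 : ζ ≠ 1) {M : Matrix (Fin 3) (Fin 3) F} (h0 : M ≠ 0) (h : M * M = 0)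
    (hP : M 0 0 + ζ * M 1 1 + ζ ^ 2 * M 2 2 = 0) : ∃ p, hexagonParam ζ p = M := by
  have ht := trace_eq_zero_of_mul_self_eq_zero h
  have hadj := adjugate_eq_zero_of_mul_self_eq_zero h h0
  rw [Matrix.trace_fin_three] at ht
  have h1 : M 1 1 = M 0 0 * ζ := by
    apply mul_left_cancel₀ (sub_ne_zero.mpr hζ1)
    grind
  have h2 : M 2 2 = M 0 0 * ζ ^ 2 := by grind
  have m := fun i j => congrFun (congrFun hadj i) j
  rw [Matrix.adjugate_fin_three] at m
  have m00 := m 0 0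
  have m01 := m 0 1
  have m02 := m 0 2
  have m10 := m 1 0
  have m11 := m 1 1
  have m12 := m 1 2
  have m20 := m 2 0
  have m21 := m 2 1
  have m22 := m 2 2
  simp [h1, h2] at m00 m01 m02 m10 m11 m12 m20 m21 m22
  clear m hadj h hP ht
  have hζ0 : ζ ≠ 0 := by rintro rfl; simp at hζ
  by_cases t0 : M 0 0 = 0
  · simp only [t0, zero_mul, mul_zero, sub_zero, zero_sub, neg_eq_zero, neg_zero, zero_add,
      mul_eq_zero] at h1 h2 m00 m01 m02 m10 m11 m12 m20 m21 m22
    by_cases h01 : M 0 1 = 0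
    · by_cases h12 : M 1 2 = 0
      · by_cases h20 : M 2 0 = 0
        · by_cases h10 : M 1 0 = 0
          · by_cases h21 : M 2 1 = 0
            · have h02 : M 0 2 ≠ 0 := by
                intro h02
                apply h0
                rw [Matrix.eta_fin_three M]
                ext i j
                fin_cases i <;> fin_cases j <;> simp [*]
              refine ⟨.inr (5, Units.mk0 _ h02, M 1 2), .trans ?_ M.eta_fin_three.symm⟩
              simp_all [hexagonParam]
            · refine ⟨.inr (4, Units.mk0 _ h21, M 0 1), .trans ?_ M.eta_fin_three.symm⟩
              simp_all [hexagonParam]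
          · refine ⟨.inr (3, Units.mk0 _ h10, M 2 0), .trans ?_ M.eta_fin_three.symm⟩
            simp_all [hexagonParam]
        · by_cases h10 : M 1 0 = 0
          · refine ⟨.inr (2, Units.mk0 _ h20, M 2 1), .trans ?_ M.eta_fin_three.symm⟩
            simp_all [hexagonParam]
          · refine ⟨.inr (3, Units.mk0 _ h10, M 2 0), .trans ?_ M.eta_fin_three.symm⟩
            simp_all [hexagonParam]
      · by_cases h02 : M 0 2 = 0
        · refine ⟨.inr (1, Units.mk0 _ h12, M 1 0), .trans ?_ M.eta_fin_three.symm⟩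
          simp_all [hexagonParam]
        · refine ⟨.inr (5, Units.mk0 _ h02, M 1 2), .trans ?_ M.eta_fin_three.symm⟩
          simp_all [hexagonParam]
    · by_cases h21 : M 2 1 = 0
      · refine ⟨.inr (0, Units.mk0 _ h01, M 0 2), .trans ?_ M.eta_fin_three.symm⟩
        simp_all [hexagonParam]
      · refine ⟨.inr (4, Units.mk0 _ h21, M 0 1), .trans ?_ M.eta_fin_three.symm⟩
        simp_all [hexagonParam]
  · have hx : M 1 0 ≠ 0 := by grind
    have hy : M 2 0 ≠ 0 := by grind
    refine ⟨.inl (Units.mk0 _ t0, Units.mk0 _ (div_ne_zero hx t0),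
      Units.mk0 _ (div_ne_zero hy t0)), ?_⟩
    ext i j
    fin_cases i <;> fin_cases j <;> simp [hexagonParam, h1, h2] <;> field_simp <;> grind

theorem hexagon_points_in_P3_perp
    (F : Type*) [Field F] [Fintype F] (q : ℕ)
    (hcard : Fintype.card F = q) (hq : q % 3 = 1)
    (ζ : F) (hζ3 : ζ ^ 3 = 1) (hζ1 : ζ ≠ 1) :
    {M : Matrix (Fin 3) (Fin 3) F | M ≠ 0 ∧ M * M = 0 ∧
        M 0 0 + ζ * M 1 1 + ζ ^ 2 * M 2 2 = 0}.ncard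
      = (q - 1) * (q ^ 2 + 4 * q + 1) := by
  have hζ : 1 + ζ + ζ ^ 2 = 0 := by
    apply mul_left_cancel₀ (sub_ne_zero.mpr hζ1)
    linear_combination hζ3
  have hset : {M : Matrix (Fin 3) (Fin 3) F | M ≠ 0 ∧ M * M = 0 ∧
      M 0 0 + ζ * M 1 1 + ζ ^ 2 * M 2 2 = 0} = Set.range (hexagonParam ζ) := by
    ext M
    constructor
    · rintro ⟨h0, h, hP⟩
      exact exists_hexagonParam_eq hζ hζ1 h0 h hP
    · rintro ⟨p, rfl⟩
      exact hexagonParam_mem hζ p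
  have hunits : Nat.card Fˣ = q - 1 := by
    rw [Nat.card_units, Nat.card_eq_fintype_card, hcard]
  rw [hset, ← Set.image_univ, Set.ncard_image_of_injective _ (hexagonParam_injective ζ),
    Set.ncard_univ]
  simp only [Nat.card_sum, Nat.card_prod, hunits, Nat.card_fin, Nat.card_eq_fintype_card (α := F),
    hcard]
  obtain ⟨r, rfl⟩ : ∃ r, q = r + 1 := ⟨q - 1, by omega⟩
  rw [Nat.add_sub_cancel]
  ring
end

section
/- Let F be a finite field with q elements, q ≡ 1 (mod 3), and let ω ∈ F be a nonzero element that is not a cube. The number of nonzero 3×3 matrices M over F with M² = 0 and M₂₁ + M₃₂ + ω·M₁₃ = 0 equals (q−1)(q²+q+1). (This expresses that the hyperplane P₄^⊥, where P₄ = E₁₂ + E₂₃ + ω·E₃₁, contains exactly q²+q+1 points of the hexagon Γ.) -/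
open scoped Matrix LinearAlgebra.Projectivization

namespace Matrix

/-- A matrix of rank at most one is an outer product. -/
lemma exists_eq_vecMulVec_of_rank_le_one {m n K : Type*} [Fintype m] [Fintype n] [Field K]
    {M : Matrix m n K} (hM : M.rank ≤ 1) : ∃ v w, M = vecMulVec v w := by
  classical
  have hP := (Submodule.finrank_le_one_iff_isPrincipal (LinearMap.range M.mulVecLin)).1 hM
  obtain ⟨v, hv⟩ := hP.principal
  have hcol (j : n) : ∃ c : K, c • v = M.col j := by
    rw [← Submodule.mem_span_singleton, ← hv]
    exact ⟨Pi.single j 1, by simp⟩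
  choose w hw using hcol
  refine ⟨v, w, ?_⟩
  ext i j
  simpa [vecMulVec_apply, mul_comm] using (congrFun (hw j) i).symm

/-- A `3 × 3` matrix of square zero is an outer product. -/
lemma exists_eq_vecMulVec_of_mul_self_eq_zero {K : Type*} [Field K]
    {M : Matrix (Fin 3) (Fin 3) K} (hM : M * M = 0) : ∃ v w, M = vecMulVec v w := by
  refine exists_eq_vecMulVec_of_rank_le_one ?_
  have h := rank_add_rank_le_card_of_mul_eq_zero hM
  rw [Fintype.card_fin] at h
  lia

end Matrix

namespace TwistedShift

variable {F : Type*} [Field F]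

/-- The twisted cyclic shift `(x, y, z) ↦ (y, z, ω x)`, with characteristic polynomial `X³ - ω`. -/
def shift (ω : F) (v : Fin 3 → F) : Fin 3 → F := ![v 1, v 2, ω * v 0]

/-- The cross product of `v` with its twisted cyclic shift. -/
def normal (ω : F) (v : Fin 3 → F) : Fin 3 → F := crossProduct v (shift ω v)

lemma normal_eq (ω : F) (v : Fin 3 → F) :
    normal ω v = ![v 1 * (ω * v 0) - v 2 * v 2, v 2 * v 1 - v 0 * (ω * v 0),
      v 0 * v 2 - v 1 * v 1] := by
  simp [normal, shift, cross_apply]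

lemma normal_smul (ω t : F) (v : Fin 3 → F) : normal ω (t • v) = t ^ 2 • normal ω v := by
  ext i
  fin_cases i <;> simp [normal_eq] <;> ring

lemma normal_ne_zero {ω : F} (hω : ¬ ∃ u : F, u ^ 3 = ω) {v : Fin 3 → F} (hv : v ≠ 0) :
    normal ω v ≠ 0 := by
  intro h
  have h0 : v 1 * (ω * v 0) - v 2 * v 2 = 0 := by simpa [normal_eq] using congrFun h 0
  have h2 : v 0 * v 2 - v 1 * v 1 = 0 := by simpa [normal_eq] using congrFun h 2
  by_cases hx : v 0 = 0
  · have hz : v 2 = 0 := by simpa [hx] using h0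
    have hy : v 1 = 0 := by simpa [hx] using h2
    exact hv (by ext i; fin_cases i <;> simp [hx, hy, hz])
  · have h1 : v 2 * v 1 - v 0 * (ω * v 0) = 0 := by simpa [normal_eq] using congrFun h 1
    refine hω ⟨v 1 / v 0, ?_⟩
    field_simp
    linear_combination v 0 * h1 - v 1 * h2

/-- A vector orthogonal to `v` and to its shift is a multiple of `normal ω v`. -/
lemma exists_eq_smul_normal {ω : F} {v w : Fin 3 → F} (hn : normal ω v ≠ 0)
    (hv : w ⬝ᵥ v = 0) (hs : w ⬝ᵥ shift ω v = 0) : ∃ c : F, w = c • normal ω v := by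
  have hc : crossProduct w (normal ω v) = 0 := by
    rw [normal, cross_cross_eq_smul_sub_smul', hs, dotProduct_comm v w, hv]
    simp
  obtain ⟨k, hk⟩ := Function.ne_iff.1 hn
  rw [Pi.zero_apply] at hk
  refine ⟨w k / normal ω v k, ?_⟩
  have h0 := congrFun hc 0
  have h1 := congrFun hc 1
  have h2 := congrFun hc 2
  simp only [cross_apply, Matrix.cons_val, Pi.zero_apply] at h0 h1 h2
  ext i
  rw [Pi.smul_apply, smul_eq_mul, div_mul_eq_mul_div, eq_div_iff hk]
  fin_cases k <;> fin_cases i <;> simp only [Fin.zero_eta, Fin.mk_one, Fin.reduceFinMk] <;> grind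

/-- The square-zero matrices `M` orthogonal to `E₁₂ + E₂₃ + ω E₃₁`. -/
def hexagonSection (ω : F) : Set (Matrix (Fin 3) (Fin 3) F) :=
  {M | M ≠ 0 ∧ M * M = 0 ∧ M 1 0 + M 2 1 + ω * M 0 2 = 0}

lemma vecMulVec_mem_hexagonSection_iff (ω : F) {v w : Fin 3 → F} (hv : v ≠ 0) (hw : w ≠ 0) :
    Matrix.vecMulVec v w ∈ hexagonSection ω ↔ w ⬝ᵥ v = 0 ∧ w ⬝ᵥ shift ω v = 0 := by
  have hsq : Matrix.vecMulVec v w * Matrix.vecMulVec v w = 0 ↔ w ⬝ᵥ v = 0 := by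
    rw [Matrix.vecMulVec_mul_vecMulVec]
    simp [hv, hw]
  have hlin : w ⬝ᵥ shift ω v = v 1 * w 0 + v 2 * w 1 + ω * (v 0 * w 2) := by
    simp only [shift, Matrix.vec3_dotProduct, Matrix.cons_val]
    ring
  simp [hexagonSection, hsq, hlin, hv, hw, Matrix.vecMulVec_apply]

/-- The matrix `c v (normal ω v)ᵀ` attached to a nonzero scalar `c` and a point `⟨v⟩`. -/
noncomputable def sectionMatrix (ω : F) (p : Fˣ × ℙ F (Fin 3 → F)) :
    Matrix (Fin 3) (Fin 3) F :=
  Matrix.vecMulVec p.2.rep ((p.1 : F) • normal ω p.2.rep)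

lemma sectionMatrix_injective {ω : F} (hω : ¬ ∃ u : F, u ^ 3 = ω) :
    Function.Injective (sectionMatrix ω) := by
  rintro ⟨c, x⟩ ⟨d, y⟩ h
  have hx := normal_ne_zero hω x.rep_nonzero
  have hxy : x = y := by
    obtain ⟨j, hj⟩ := Function.ne_iff.1 hx
    rw [Pi.zero_apply] at hj
    rw [← x.mk_rep, ← y.mk_rep, Projectivization.mk_eq_mk_iff']
    refine ⟨d * normal ω y.rep j / (c * normal ω x.rep j), ?_⟩
    ext i
    have hij := congrFun (congrFun h i) j
    simp only [sectionMatrix, Matrix.vecMulVec_apply, Pi.smul_apply, smul_eq_mul] at hij ⊢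
    have hc := c.ne_zero
    field_simp
    linear_combination -hij
  subst hxy
  simp only [sectionMatrix, Matrix.vecMulVec_smul] at h
  have hcd := smul_left_injective F (Matrix.vecMulVec_ne_zero x.rep_nonzero hx) h
  rw [Units.ext hcd]

lemma range_sectionMatrix {ω : F} (hω : ¬ ∃ u : F, u ^ 3 = ω) :
    Set.range (sectionMatrix ω) = hexagonSection ω := by
  ext M
  constructor
  · rintro ⟨⟨c, x⟩, rfl⟩
    rw [sectionMatrix, vecMulVec_mem_hexagonSection_iff ω x.rep_nonzero
      (smul_ne_zero c.ne_zero (normal_ne_zero hω x.rep_nonzero))]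
    rw [smul_dotProduct, smul_dotProduct, normal, dotProduct_comm, dot_self_cross,
      dotProduct_comm, dot_cross_self]
    simp
  · intro hM
    obtain ⟨v, w, rfl⟩ := Matrix.exists_eq_vecMulVec_of_mul_self_eq_zero hM.2.1
    have hvw := hM.1
    rw [Ne, Matrix.vecMulVec_eq_zero, not_or] at hvw
    obtain ⟨hv, hw⟩ := hvw
    rw [vecMulVec_mem_hexagonSection_iff ω hv hw] at hM
    obtain ⟨c, rfl⟩ := exists_eq_smul_normal (normal_ne_zero hω hv) hM.1 hM.2
    have hc : c ≠ 0 := fun h => hw (by simp [h])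
    obtain ⟨a, ha⟩ := Projectivization.exists_smul_eq_mk_rep F v hv
    rw [Units.smul_def] at ha
    refine ⟨⟨Units.mk0 c hc * (a ^ 3)⁻¹, Projectivization.mk F v hv⟩, ?_⟩
    have ha0 := a.ne_zero
    rw [sectionMatrix, ← ha, normal_smul]
    ext i j
    simp only [Matrix.vecMulVec_apply, Units.val_mul, Units.val_mk0, Units.val_inv_eq_inv_val,
      Units.val_pow_eq_pow_val, Pi.smul_apply, smul_eq_mul]
    field_simp

end TwistedShift

theorem hexagon_points_in_P4_perp
    (F : Type*) [Field F] [Fintype F] (q : ℕ)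
    (hcard : Fintype.card F = q) (hq : q % 3 = 1)
    (ω : F) (hω : ω ≠ 0) (hncube : ¬ ∃ u : F, u ^ 3 = ω) :
    {M : Matrix (Fin 3) (Fin 3) F | M ≠ 0 ∧ M * M = 0 ∧
        M 1 0 + M 2 1 + ω * M 0 2 = 0}.ncard
      = (q - 1) * (q ^ 2 + q + 1) := by
  classical
  change (TwistedShift.hexagonSection ω).ncard = _
  rw [← TwistedShift.range_sectionMatrix hncube,
    Set.ncard_range_of_injective (TwistedShift.sectionMatrix_injective hncube), Nat.card_prod,
    Projectivization.card_of_finrank F (Fin 3 → F) (Module.finrank_fin_fun F),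
    Nat.card_eq_fintype_card, Nat.card_eq_fintype_card, Fintype.card_units, hcard]
  simp only [Finset.sum_range_succ, Finset.sum_range_zero]
  ring
end
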